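/- With K, 𝔟, ω = [[a₀,…,a_{r−1}]], ℓ, α_i, β_i, Q as in the context: ζ(0,𝔟) = (1/12)·Σ_{i=0}^{ℓ−1} (−1)ⁱ·a_i. -/

import Mathlib

open NumberField
open scoped nonZeroDivisors
open Classical

noncomputable section

/-- The weight function of the (oriented) lattice cone spanned by `v₁, v₂`:
`1` on interior lattice points, `1/2` on nonzero lattice points of the boundary rays,
`0` elsewhere. -/
def wt (v₁ v₂ : ℝ × ℝ) (m : ℤ × ℤ) : ℝ :=
  if ∃ x₁ x₂ : ℝ, 0 < x₁ ∧ 0 < x₂ ∧ ((m.1 : ℝ), (m.2 : ℝ)) = x₁ • v₁ + x₂ • v₂ then 1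
  else if ∃ t : ℝ, 0 < t ∧
      (((m.1 : ℝ), (m.2 : ℝ)) = t • v₁ ∨ ((m.1 : ℝ), (m.2 : ℝ)) = t • v₂) then 1 / 2
  else 0

section
open Real MeasureTheory Filter Topology Set

def pw (n : ℕ) : ℝ := if n = 0 then 1/2 else 1

lemma trap_interval (G G1 G2 G3 : ℝ → ℝ) (h1 : ∀ x, HasDerivAt G (G1 x) x)
    (h2 : ∀ x, HasDerivAt G1 (G2 x) x) (h3 : ∀ x, HasDerivAt G2 (G3 x) x)
    (hc : Continuous G3) (x0 h : ℝ) :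
    h / 2 * (G x0 + G (x0 + h)) = (∫ x in x0..(x0+h), G x) + h^2/12 * (G1 (x0+h) - G1 x0)
      + ∫ x in x0..(x0+h), ((x-x0)^3/6 - h*(x-x0)^2/4 + h^2*(x-x0)/12) * G3 x := by
  have hG : Continuous G := continuous_iff_continuousAt.2 fun x => (h1 x).continuousAt
  have hP : Continuous (fun x : ℝ => ((x-x0)^3/6 - h*(x-x0)^2/4 + h^2*(x-x0)/12)) := by fun_prop
  have key := intervalIntegral.integral_eq_sub_of_hasDerivAt (a := x0) (b := x0+h)
    (f := fun x => ((x-x0) - h/2) * G x - ((x-x0)^2/2 - h*(x-x0)/2 + h^2/12) * G1 x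
      + ((x-x0)^3/6 - h*(x-x0)^2/4 + h^2*(x-x0)/12) * G2 x)
    (f' := fun x => G x + ((x-x0)^3/6 - h*(x-x0)^2/4 + h^2*(x-x0)/12) * G3 x)
    (fun x _ => by
      have hx : HasDerivAt (fun x : ℝ => x - x0) 1 x := (hasDerivAt_id x).sub_const x0
      have a1 := (hx.sub_const (h/2)).mul (h1 x)
      have a2 := ((((hx.pow 2).div_const 2).sub ((hx.const_mul h).div_const 2)).add_const (h^2/12)).mul (h2 x)
      have a3 := ((((hx.pow 3).div_const 6).sub (((hx.pow 2).const_mul h).div_const 4)).add ((hx.const_mul (h^2)).div_const 12)).mul (h3 x)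
      have := (a1.sub a2).add a3
      refine this.congr_deriv ?_
      simp only [Pi.pow_apply, Pi.add_apply, Pi.sub_apply]
      push_cast
      ring)
    ((hG.add (hP.mul hc)).intervalIntegrable _ _)
  have hPc : Continuous (fun x : ℝ => ((x-x0)^3/6 - h*(x-x0)^2/4 + h^2*(x-x0)/12) * G3 x) := hP.mul hc
  rw [intervalIntegral.integral_add (hG.intervalIntegrable _ _) (hPc.intervalIntegrable _ _)] at key
  have : x0 + h - x0 = h := by ring
  simp only [this, sub_self] at key
  linarith

lemma trap_sum (G G1 G2 G3 : ℝ → ℝ) (h1 : ∀ x, HasDerivAt G (G1 x) x)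
    (h2 : ∀ x, HasDerivAt G1 (G2 x) x) (h3 : ∀ x, HasDerivAt G2 (G3 x) x)
    (hc : Continuous G3) (M : ℝ) (hM : ∀ x, 0 ≤ x → |G3 x| ≤ M * exp (-x))
    (h : ℝ) (hh : 0 < h) (N : ℕ) :
    |h * (∑ n ∈ Finset.range N, pw n * G (n * h)) + h / 2 * (G (N * h) - if N = 0 then G 0 else 0) 
      - (∫ x in (0:ℝ)..(N*h), G x) - h^2/12 * (G1 (N * h) - G1 0)| ≤ h^3/2 * (M * (1 - exp (-(N*h)))) := by
  have hG : Continuous G := continuous_iff_continuousAt.2 fun x => (h1 x).continuousAt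
  induction N with
  | zero => simp
  | succ N ih =>
    have key := trap_interval G G1 G2 G3 h1 h2 h3 hc (N*h) h
    have e : (N:ℝ) * h + h = ((N+1 : ℕ):ℝ) * h := by push_cast; ring
    rw [e] at key
    have hN0 : (0:ℝ) ≤ N * h := by positivity
    have hle : (N:ℝ) * h ≤ ((N+1 : ℕ):ℝ) * h := by rw [← e]; linarith
    have bd : |∫ x in (N*h:ℝ)..(((N+1 : ℕ):ℝ) * h), ((x-N*h)^3/6 - h*(x-N*h)^2/4 + h^2*(x-N*h)/12) * G3 x|
        ≤ ∫ x in (N*h:ℝ)..(((N+1 : ℕ):ℝ) * h), h^3/2 * (M * exp (-x)) := by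
      rw [← Real.norm_eq_abs]
      refine intervalIntegral.norm_integral_le_of_norm_le hle ?_ ?_
      · refine Filter.Eventually.of_forall fun x hx => ?_
        rw [Real.norm_eq_abs, abs_mul]
        have hx0 : 0 ≤ x := hN0.trans hx.1.le
        have y0 : 0 ≤ x - N*h := by linarith [hx.1]
        have y1 : x - N*h ≤ h := by linarith [hx.2]
        refine mul_le_mul ?_ (hM x hx0) (abs_nonneg _) (by positivity)
        set y := x - N*h
        have q1 : y^3 ≤ h^3 := by gcongr
        have q2 : h*y^2 ≤ h*h^2 := by gcongr
        have q3 : h^2*y ≤ h^2*h := by gcongr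
        have p1 : 0 ≤ y^3 := by positivity
        have p2 : 0 ≤ h*y^2 := by positivity
        have p3 : 0 ≤ h^2*y := by positivity
        rw [abs_le]; constructor <;> nlinarith
      · exact (by fun_prop : Continuous fun x : ℝ => h^3/2 * (M * exp (-x))).intervalIntegrable _ _
    have ev : ∫ x in (N*h:ℝ)..(((N+1 : ℕ):ℝ) * h), h^3/2 * (M * exp (-x)) = 
        h^3/2 * (M * (exp (-(N*h)) - exp (-(((N+1 : ℕ):ℝ) * h)))) := by
      rw [intervalIntegral.integral_const_mul, intervalIntegral.integral_const_mul]
      congr 2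
      rw [intervalIntegral.integral_comp_neg (fun x => exp x)]
      simp
    rw [ev] at bd
    have sp := intervalIntegral.integral_add_adjacent_intervals (μ := volume) (hG.intervalIntegrable 0 (N*h)) (hG.intervalIntegrable (N*h) (((N+1 : ℕ):ℝ) * h))
    rw [Finset.sum_range_succ, ← sp]
    have e2 : h * (∑ n ∈ Finset.range N, pw n * G (n * h) + pw N * G (N * h)) + h / 2 * (G (((N+1 : ℕ):ℝ) * h) - if N + 1 = 0 then G 0 else 0) =
      h * (∑ n ∈ Finset.range N, pw n * G (n * h)) + h / 2 * (G (N * h) - if N = 0 then G 0 else 0)  + h / 2 * (G (N * h) + G (((N+1 : ℕ):ℝ) * h)) := by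
      rcases Nat.eq_zero_or_pos N with rfl | hN
      · simp [pw]; ring
      · simp [pw, hN.ne']; ring
    rw [e2, key]
    rw [abs_le] at *
    constructor <;> nlinarith

lemma trap_full (G G1 G2 G3 : ℝ → ℝ) (h1 : ∀ x, HasDerivAt G (G1 x) x)
    (h2 : ∀ x, HasDerivAt G1 (G2 x) x) (h3 : ∀ x, HasDerivAt G2 (G3 x) x)
    (hc : Continuous G3) (M : ℝ) (hM0 : ∀ x, 0 ≤ x → |G x| ≤ M * exp (-x))
    (hM1 : ∀ x, 0 ≤ x → |G1 x| ≤ M * exp (-x))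
    (hM : ∀ x, 0 ≤ x → |G3 x| ≤ M * exp (-x))
    (h : ℝ) (hh : 0 < h) :
    |h * (∑' n : ℕ, pw n * G (n * h)) - (∫ x in Ioi (0:ℝ), G x) + h^2/12 * G1 0| ≤ h^3/2 * M := by
  have hG : Continuous G := continuous_iff_continuousAt.2 fun x => (h1 x).continuousAt
  have hMn : 0 ≤ M := by
    have := (abs_nonneg _).trans (hM 0 le_rfl)
    simpa using this
  have hexp : Tendsto (fun N : ℕ => M * exp (-(N * h))) atTop (𝓝 0) := by
    have : Tendsto (fun N : ℕ => exp (-(N * h))) atTop (𝓝 0) := by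
      refine Real.tendsto_exp_atBot.comp (tendsto_neg_atTop_atBot.comp ?_)
      exact tendsto_natCast_atTop_atTop.atTop_mul_const hh
    simpa using this.const_mul M
  have hsum : Summable (fun n : ℕ => pw n * G (n * h)) := by
    have hs : Summable (fun n : ℕ => M * exp (-(n * h))) := by
      refine Summable.mul_left _ ?_
      have := Real.summable_exp_nat_mul_iff.2 (neg_lt_zero.2 hh)
      refine this.congr fun n => by ring_nf
    refine Summable.of_norm_bounded hs fun n => ?_
    rw [norm_mul, Real.norm_eq_abs, Real.norm_eq_abs]
    have : |pw n| ≤ 1 := by unfold pw; split_ifs <;> norm_num [abs_le]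
    calc |pw n| * |G (n*h)| ≤ 1 * (M * exp (-(n*h))) := by
          gcongr; exact hM0 _ (by positivity)
      _ = _ := one_mul _
  have hInt0 : IntegrableOn G (Ioi 0) := by
    refine Integrable.mono' ((integrableOn_exp_neg_Ioi 0).const_mul M) hG.aestronglyMeasurable ?_
    filter_upwards [ae_restrict_mem measurableSet_Ioi] with x hx
    exact hM0 x (le_of_lt hx)
  have t0 : Tendsto (fun N : ℕ => G (N * h)) atTop (𝓝 0) :=
    squeeze_zero_norm (fun N => hM0 _ (by positivity)) hexp
  have t1 : Tendsto (fun N : ℕ => G1 (N * h)) atTop (𝓝 0) :=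
    squeeze_zero_norm (fun N => hM1 _ (by positivity)) hexp
  have t2 := intervalIntegral_tendsto_integral_Ioi (0:ℝ) hInt0
    (tendsto_natCast_atTop_atTop.atTop_mul_const hh)
  have t3 := hsum.hasSum.tendsto_sum_nat
  have T := (((t3.const_mul h).add (t0.const_mul (h/2))).sub t2).sub ((t1.sub_const (G1 0)).const_mul (h^2/12))
  have T' := T.abs
  have e : |h * (∑' n : ℕ, pw n * G (n * h)) - (∫ x in Ioi (0:ℝ), G x) + h^2/12 * G1 0| =
    |h * (∑' n : ℕ, pw n * G (n * h)) + h / 2 * 0 - (∫ x in Ioi (0:ℝ), G x) - h^2/12 * (0 - G1 0)| := by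
    congr 1; ring
  rw [e]
  refine le_of_tendsto T' ?_
  filter_upwards [eventually_gt_atTop 0] with N hN
  have := trap_sum G G1 G2 G3 h1 h2 h3 hc M hM h hh N
  rw [if_neg hN.ne', sub_zero] at this
  refine this.trans ?_
  have : M * (1 - exp (-(N*h))) ≤ M := by nlinarith [exp_pos (-(N*h))]
  gcongr

end

section
open Real MeasureTheory Filter Topology Set

lemma poly_gauss (μ z : ℝ) (hμ : 0 < μ) (hz : 0 ≤ z) :
    (1 + z)^4 * exp (-(μ * z^2)) ≤ exp (25/(4*μ)) * exp (-z) := by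
  have h1 : (1+z)^4 ≤ exp (4*z) := by
    have : 1 + z ≤ exp z := by linarith [add_one_le_exp z]
    calc (1+z)^4 ≤ (exp z)^4 := by gcongr
      _ = exp (4*z) := by rw [← exp_nat_mul]; norm_num
  calc (1 + z)^4 * exp (-(μ * z^2)) ≤ exp (4*z) * exp (-(μ * z^2)) := by gcongr
    _ = exp (4*z - μ*z^2) := by rw [← exp_add]; ring_nf
    _ ≤ exp (25/(4*μ) - z) := by
        apply exp_le_exp.2
        have : 25/(4*μ) - 5*z + μ*z^2 = (5 - 2*μ*z)^2/(4*μ) := by field_simp; ring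
        have : 0 ≤ (5 - 2*μ*z)^2/(4*μ) := by positivity
        linarith
    _ = _ := by rw [← exp_add]; ring_nf

/-- bound: polynomially bounded times gaussian -/
lemma poly_gauss' (μ z p v D : ℝ) (hμ : 0 < μ) (hz : 0 ≤ z) (hv0 : 0 ≤ v) (hv : v ≤ exp (-(μ * z^2)))
    (hD : 0 ≤ D) (hp : |p| ≤ D * (1+z)^4) :
    |p * v| ≤ D * exp (25/(4*μ)) * exp (-z) := by
  rw [abs_mul, abs_of_nonneg hv0]
  calc |p| * v ≤ (D * (1+z)^4) * exp (-(μ * z^2)) := by gcongr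
    _ = D * ((1+z)^4 * exp (-(μ * z^2))) := by ring
    _ ≤ D * (exp (25/(4*μ)) * exp (-z)) := mul_le_mul_of_nonneg_left (poly_gauss μ z hμ hz) hD
    _ = _ := by ring

/-- the x-slices of the two-variable Gaussian -/
lemma slice_trap (a b c : ℝ) (ha : 0 < a) (hb : 0 < b) (hc : 0 < c) :
    ∃ M : ℝ, 0 ≤ M ∧ (∀ x y, 0 ≤ x → 0 ≤ y → exp (-(a*x^2+b*x*y+c*y^2)) ≤ M * exp (-x) * exp (-y)) ∧ 
     ∀ y h : ℝ, 0 ≤ y → 0 < h →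
      |h * (∑' n : ℕ, pw n * exp (-(a*(n*h)^2+b*(n*h)*y+c*y^2))) -
        (∫ x in Ioi (0:ℝ), exp (-(a*x^2+b*x*y+c*y^2))) - h^2/12 * (b * y * exp (-(c*y^2)))| ≤ h^3/2 * (M * exp (-y)) := by
  obtain ⟨μ, hμ, hμa, hμb, hμc⟩ : ∃ μ : ℝ, 0 < μ ∧ μ ≤ a ∧ 2*μ ≤ b ∧ μ ≤ c := by
    refine ⟨min a (min (b/2) c), by positivity, min_le_left _ _, ?_, ?_⟩
    · have : min a (min (b/2) c) ≤ b/2 := (min_le_right _ _).trans (min_le_left _ _)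
      linarith
    · exact (min_le_right _ _).trans (min_le_right _ _)
  set B := 2*a+b with hB
  have hBp : 0 < B := by positivity
  set D := 1 + B + B^3 + 6*a*B with hD
  have hDp : 0 ≤ D := by positivity
  have hv : ∀ x y : ℝ, 0 ≤ x → 0 ≤ y → exp (-(a*x^2+b*x*y+c*y^2)) ≤ exp (-(μ * (x+y)^2)) := by
    intro x y hx hy
    apply exp_le_exp.2
    have := mul_nonneg hx hy
    nlinarith [mul_le_mul_of_nonneg_right hμa (sq_nonneg x), mul_le_mul_of_nonneg_right hμc (sq_nonneg y), mul_le_mul_of_nonneg_right hμb this]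
  have bound : ∀ x y p : ℝ, 0 ≤ x → 0 ≤ y → |p| ≤ D * (1 + (x+y))^4 → 
      |p * exp (-(a*x^2+b*x*y+c*y^2))| ≤ (D * exp (25/(4*μ)) * exp (-y)) * exp (-x) := by
    intro x y p hx hy hp
    have := poly_gauss' μ (x+y) p _ D hμ (by positivity) (exp_pos _).le (hv x y hx hy) hDp hp
    refine this.trans (le_of_eq ?_)
    rw [show -(x+y) = -y + -x by ring, exp_add]; ring
  have pz : ∀ z : ℝ, 0 ≤ z → 1 ≤ (1+z)^4 ∧ z ≤ (1+z)^4 ∧ z^3 ≤ (1+z)^4 := by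
    intro z hz
    refine ⟨?_, ?_, ?_⟩
    · exact one_le_pow₀ (by linarith)
    · have := pow_le_pow_right₀ (show 1 ≤ 1+z by linarith) (show 1 ≤ 4 by norm_num)
      linarith
    · have := pow_le_pow_right₀ (show 1 ≤ 1+z by linarith) (show 3 ≤ 4 by norm_num)
      have h2 : z^3 ≤ (1+z)^3 := by gcongr; linarith
      linarith
  have hub : ∀ x y : ℝ, 0 ≤ x → 0 ≤ y → 0 ≤ 2*a*x+b*y ∧ 2*a*x+b*y ≤ B*(x+y) := by
    intro x y hx hy
    refine ⟨by positivity, ?_⟩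
    rw [hB]; nlinarith [mul_nonneg ha.le hy, mul_nonneg hb.le hx]
  have P0 : ∀ x y : ℝ, 0 ≤ x → 0 ≤ y → |(1:ℝ)| ≤ D * (1 + (x+y))^4 := by
    intro x y hx hy
    obtain ⟨p1, p2, p3⟩ := pz (x+y) (by positivity)
    rw [abs_one]
    have : 1 ≤ D := by rw [hD]; nlinarith [pow_pos hBp 3, mul_pos ha hBp]
    nlinarith
  refine ⟨D * exp (25/(4*μ)), by positivity, ?_, ?_⟩
  · intro x y hx hy
    have := bound x y 1 hx hy (P0 x y hx hy)
    rw [one_mul, abs_of_pos (exp_pos _)] at this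
    linarith
  intro y h hy hh
  have hE : ∀ x : ℝ, HasDerivAt (fun x => exp (-(a*x^2+b*x*y+c*y^2))) (-(2*a*x+b*y) * exp (-(a*x^2+b*x*y+c*y^2))) x := by
    intro x
    have hx := hasDerivAt_id x
    have := (((((hx.pow 2).const_mul a).add ((hx.const_mul b).mul_const y)).add_const (c*y^2)).neg).exp
    refine this.congr_deriv ?_
    simp; ring
  have hu : ∀ x : ℝ, HasDerivAt (fun x => 2*a*x+b*y) (2*a) x := by
    intro x
    simpa using ((hasDerivAt_id x).const_mul (2*a)).add_const (b*y)
  have key := trap_full (fun x => exp (-(a*x^2+b*x*y+c*y^2)))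
    (fun x => -(2*a*x+b*y) * exp (-(a*x^2+b*x*y+c*y^2)))
    (fun x => ((2*a*x+b*y)^2 - 2*a) * exp (-(a*x^2+b*x*y+c*y^2)))
    (fun x => (-(2*a*x+b*y)^3 + 6*a*(2*a*x+b*y)) * exp (-(a*x^2+b*x*y+c*y^2)))
    hE
    (fun x => by
      refine ((hu x).neg.mul (hE x)).congr_deriv ?_
      simp; ring)
    (fun x => by
      refine ((((hu x).pow 2).sub_const (2*a)).mul (hE x)).congr_deriv ?_
      simp; ring)
    (by fun_prop) (D * exp (25/(4*μ)) * exp (-y))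
    (fun x hx => by
      have := bound x y 1 hx hy (P0 x y hx hy)
      rwa [one_mul] at this)
    (fun x hx => by
      refine bound x y _ hx hy ?_
      obtain ⟨u0, u1⟩ := hub x y hx hy
      obtain ⟨p1, p2, p3⟩ := pz (x+y) (by positivity)
      rw [abs_neg, abs_of_nonneg u0]
      have q : B * (x+y) ≤ B * (1+(x+y))^4 := by gcongr
      have : B ≤ D := by rw [hD]; nlinarith [pow_pos hBp 3, mul_pos ha hBp]
      nlinarith)
    (fun x hx => by
      refine bound x y _ hx hy ?_
      obtain ⟨u0, u1⟩ := hub x y hx hy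
      obtain ⟨p1, p2, p3⟩ := pz (x+y) (by positivity)
      set u := 2*a*x+b*y
      have c1 : |-u^3 + 6*a*u| ≤ u^3 + 6*a*u := by
        have : 0 ≤ u^3 := by positivity
        have : 0 ≤ a*u := by positivity
        rw [abs_le]; constructor <;> linarith
      have c2 : u^3 ≤ B^3*(1+(x+y))^4 := by
        calc u^3 ≤ (B*(x+y))^3 := by gcongr
          _ = B^3*(x+y)^3 := by ring
          _ ≤ _ := by gcongr
      have c3 : 6*a*u ≤ 6*a*B*(1+(x+y))^4 := by
        calc 6*a*u ≤ 6*a*(B*(x+y)) := by gcongr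
          _ = 6*a*B*(x+y) := by ring
          _ ≤ _ := by gcongr
      have c4 : D * (1+(x+y))^4 = (1+B)*(1+(x+y))^4 + B^3*(1+(x+y))^4 + 6*a*B*(1+(x+y))^4 := by rw [hD]; ring
      have c5 : 0 ≤ (1+B)*(1+(x+y))^4 := by positivity
      linarith)
    h hh
  refine le_of_eq_of_le ?_ key
  simp
  congr 1

/-- the inner integral -/
def JJ (a b c y : ℝ) : ℝ := exp ((b^2/(4*a) - c)*y^2) * (√(π/a)/2 - ∫ u in (0:ℝ)..(b*y/(2*a)), exp (-a*u^2))

lemma JJ_eq (a b c : ℝ) (ha : 0 < a) (y : ℝ) :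
    ∫ x in Ioi (0:ℝ), exp (-(a*x^2+b*x*y+c*y^2)) = JJ a b c y := by
  set z := b*y/(2*a) with hz
  have e1 : ∀ x : ℝ, exp (-(a*x^2+b*x*y+c*y^2)) = exp ((b^2/(4*a) - c)*y^2) * exp (-a*(x+z)^2) := by
    intro x
    rw [← exp_add]; congr 1; rw [hz]; field_simp; ring
  simp_rw [e1]
  rw [integral_const_mul, JJ]
  congr 1
  have hgi : Integrable (fun u : ℝ => exp (-a*u^2)) := integrable_exp_neg_mul_sq ha
  have := (measurePreserving_add_right volume z).setIntegral_preimage_emb (measurableEmbedding_addRight z) (fun u : ℝ => exp (-a*u^2)) (Ioi z)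
  have hpre : (fun x => x + z) ⁻¹' (Ioi z) = Ioi 0 := by ext x; simp
  rw [hpre] at this
  rw [this, ← integral_gaussian_Ioi, ← hz]
  have := intervalIntegral.integral_Ioi_sub_Ioi' (hgi.integrableOn (s := Ioi 0)) (hgi.integrableOn (s := Ioi z))
  linarith

lemma JJ_bound (a b c : ℝ) (ha : 0 < a) (hb : 0 < b) (y : ℝ) (hy : 0 ≤ y) :
    |JJ a b c y| ≤ (√(π/a)/2) * exp (-(c*y^2)) := by
  rw [← JJ_eq a b c ha, abs_of_nonneg (integral_nonneg fun x => (exp_pos _).le), ← integral_gaussian_Ioi, ← integral_mul_const]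
  refine integral_mono_of_nonneg (Eventually.of_forall fun x => (exp_pos _).le) 
    (((integrable_exp_neg_mul_sq ha).integrableOn).mul_const _) ?_
  filter_upwards [ae_restrict_mem measurableSet_Ioi] with x hx
  have hx : 0 < x := hx
  rw [← exp_add]
  apply exp_le_exp.2
  have : 0 ≤ b*x*y := by positivity
  linarith

lemma JJ_deriv (a b c : ℝ) (ha : 0 < a) (y : ℝ) :
    HasDerivAt (JJ a b c) ((b^2/(2*a)-2*c)*y*JJ a b c y - b/(2*a) * exp (-(c*y^2))) y := by
  have hx := hasDerivAt_id y
  have h1 := ((hx.pow 2).const_mul (b^2/(4*a) - c)).exp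
  have hcont : Continuous (fun u : ℝ => exp (-a*u^2)) := by fun_prop
  have h2 := (hcont.integral_hasStrictDerivAt 0 (b*y/(2*a))).hasDerivAt
  have h3 : HasDerivAt (fun y : ℝ => b*y/(2*a)) (b/(2*a)) y := by
    simpa using (hx.const_mul b).div_const (2*a)
  have h4 := (h2.comp y h3).const_sub (√(π/a)/2)
  refine (h1.mul h4).congr_deriv ?_
  have e : exp (-(c*y^2)) = exp ((b^2/(4*a) - c)*y^2) * exp (-a * (b*y/(2*a))^2) := by
    rw [← exp_add]; congr 1; field_simp; ring
  rw [e, JJ]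
  simp
  ring
end

section
open Real MeasureTheory Filter Topology Set

lemma gauss_deriv (c y : ℝ) : HasDerivAt (fun y => exp (-(c*y^2))) (-(2*c*y) * exp (-(c*y^2))) y := by
  have := ((((hasDerivAt_id y).pow 2).const_mul c).neg).exp
  refine this.congr_deriv ?_
  simp; ring

lemma JJ_trap (a b c : ℝ) (ha : 0 < a) (hb : 0 < b) (hc : 0 < c) :
    ∃ M : ℝ, 0 ≤ M ∧ (∀ y, 0 ≤ y → |JJ a b c y| ≤ M * exp (-y)) ∧ ∀ h : ℝ, 0 < h →
      |h * (∑' n : ℕ, pw n * JJ a b c (n*h)) -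
        (∫ x in Ioi (0:ℝ), JJ a b c x) - h^2/12 * (b/(2*a))| ≤ h^3/2 * M := by
  set κ := b^2/(2*a)-2*c with hκ
  set β := b/(2*a) with hβ
  have hβp : 0 < β := by positivity
  set C := √(π/a)/2 with hC
  have hCp : 0 ≤ C := by positivity
  set k := |κ| with hk
  have hkp : 0 ≤ k := abs_nonneg _
  set J := JJ a b c with hJ
  set E := fun y : ℝ => exp (-(c*y^2)) with hE
  set J1 := fun y => κ*y*J y - β*E y with hJ1
  set J2 := fun y => κ*J y + κ*y*J1 y + 2*c*β*(y*E y) with hJ2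
  set J3 := fun y => 2*κ*J1 y + κ*y*J2 y + 2*c*β*E y - 4*c^2*β*(y^2*E y) with hJ3
  have dE : ∀ y, HasDerivAt E (-(2*c*y) * E y) y := fun y => gauss_deriv c y
  have d1 : ∀ y, HasDerivAt J (J1 y) y := fun y => JJ_deriv a b c ha y
  have hid : ∀ y : ℝ, HasDerivAt (fun y : ℝ => y) 1 y := fun y => hasDerivAt_id y
  have d2 : ∀ y, HasDerivAt J1 (J2 y) y := fun y => by
    refine ((((hid y).const_mul κ).mul (d1 y)).sub ((dE y).const_mul β)).congr_deriv ?_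
    simp only [hJ2]; ring
  have d3 : ∀ y, HasDerivAt J2 (J3 y) y := fun y => by
    refine ((((d1 y).const_mul κ).add (((hid y).const_mul κ).mul (d2 y))).add
      (((hid y).mul (dE y)).const_mul (2*c*β))).congr_deriv ?_
    simp only [hJ3]; ring
  have cJ : Continuous J := continuous_iff_continuousAt.2 fun x => (d1 x).continuousAt
  have cJ1 : Continuous J1 := continuous_iff_continuousAt.2 fun x => (d2 x).continuousAt
  have cJ2 : Continuous J2 := continuous_iff_continuousAt.2 fun x => (d3 x).continuousAt
  have cE : Continuous E := continuous_iff_continuousAt.2 fun x => (dE x).continuousAt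
  have cJ3 : Continuous J3 := by
    simp only [hJ3]; fun_prop
  have Epos : ∀ y, 0 < E y := fun y => exp_pos _
  have b0 : ∀ y, 0 ≤ y → |J y| ≤ C * E y := fun y hy => JJ_bound a b c ha hb y hy
  have b1 : ∀ y, 0 ≤ y → |J1 y| ≤ (k*C+β) * (1+y) * E y := fun y hy => by
    calc |J1 y| ≤ |κ*y*J y| + |β*E y| := abs_sub _ _
      _ = k*y*|J y| + β * E y := by
        rw [abs_mul, abs_mul, abs_of_nonneg hy, abs_of_pos (mul_pos hβp (Epos y))]
      _ ≤ k*y*(C*E y) + β * E y := by gcongr; exact b0 y hy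
      _ ≤ (k*C+β) * (1+y) * E y := by
        have := Epos y
        have : 0 ≤ k*C*E y := by positivity
        have : 0 ≤ β*y*E y := by positivity
        nlinarith
  set D1 := k*C+β
  have hD1 : 0 ≤ D1 := by positivity
  have b2 : ∀ y, 0 ≤ y → |J2 y| ≤ (k*C+k*D1+2*c*β) * (1+y)^2 * E y := fun y hy => by
    have hEy := Epos y
    calc |J2 y| ≤ |κ*J y| + |κ*y*J1 y| + |2*c*β*(y*E y)| := abs_add_three _ _ _
      _ = k*|J y| + k*y*|J1 y| + 2*c*β*y * E y := by
        rw [abs_mul, abs_mul, abs_mul κ y, abs_of_nonneg hy, abs_of_nonneg (a := 2*c*β*(y*E y)) (by positivity)]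
        ring
      _ ≤ k*(C*E y) + k*y*(D1 * (1+y) * E y) + 2*c*β*y * E y := by
        gcongr
        · exact b0 y hy
        · exact b1 y hy
      _ = (k*C + k*D1*(y*(1+y)) + 2*c*β*y) * E y := by ring
      _ ≤ (k*C*(1+y)^2 + k*D1*(1+y)^2 + 2*c*β*(1+y)^2) * E y := by
        have : 1 ≤ (1+y)^2 := by nlinarith
        have h1 : k*C ≤ k*C*(1+y)^2 := le_mul_of_one_le_right (by positivity) this
        gcongr
        · nlinarith
        · nlinarith
      _ = _ := by ring
  set D2 := k*C+k*D1+2*c*β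
  have hD2 : 0 ≤ D2 := by positivity
  have b3 : ∀ y, 0 ≤ y → |J3 y| ≤ (2*k*D1+k*D2+2*c*β+4*c^2*β) * (1+y)^4 * E y := fun y hy => by
    have hEy := Epos y
    have o1 : (1:ℝ) ≤ (1+y)^4 := one_le_pow₀ (by linarith)
    have o2 : (1+y) ≤ (1+y)^4 := le_self_pow₀ (by linarith) (by norm_num)
    have o3 : y^2 ≤ (1+y)^4 := by
      have : (1+y)^2 ≤ (1+y)^4 := pow_le_pow_right₀ (by linarith) (by norm_num)
      nlinarith
    have o4 : y*(1+y)^2 ≤ (1+y)^4 := by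
      have : (1+y)^3 ≤ (1+y)^4 := pow_le_pow_right₀ (by linarith) (by norm_num)
      nlinarith [sq_nonneg (1+y)]
    calc |J3 y| ≤ |2*κ*J1 y| + |κ*y*J2 y| + |2*c*β*E y| + |4*c^2*β*(y^2*E y)| := by
          refine (abs_sub _ _).trans ?_
          gcongr
          exact abs_add_three _ _ _
      _ = 2*k*|J1 y| + k*y*|J2 y| + 2*c*β * E y + 4*c^2*β*y^2* E y := by
        rw [abs_mul, abs_mul, abs_mul (κ*y), abs_mul κ y, abs_of_nonneg hy, abs_of_nonneg (a := 2*c*β*E y) (by positivity), abs_of_nonneg (a := 4*c^2*β*(y^2*E y)) (by positivity), abs_two]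
        ring
      _ ≤ 2*k*(D1 * (1+y) * E y) + k*y*(D2 * (1+y)^2 * E y) + 2*c*β * E y + 4*c^2*β*y^2* E y := by
        gcongr
        · exact b1 y hy
        · exact b2 y hy
      _ = (2*k*D1*(1+y) + k*D2*(y*(1+y)^2) + 2*c*β*1 + 4*c^2*β*y^2) * E y := by ring
      _ ≤ (2*k*D1*(1+y)^4 + k*D2*(1+y)^4 + 2*c*β*(1+y)^4 + 4*c^2*β*(1+y)^4) * E y := by
        gcongr
      _ = _ := by ring
  set D3 := 2*k*D1+k*D2+2*c*β+4*c^2*β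
  have hD3 : 0 ≤ D3 := by positivity
  have fin : ∀ D y v : ℝ, 0 ≤ y → D ≤ C + D1 + D3 → v ≤ D * (1+y)^4 * E y → 
      v ≤ ((C+D1+D3) * exp (25/(4*c))) * exp (-y) := by
    intro D y v hy hD hv
    have := poly_gauss c y hc hy
    calc v ≤ D * (1+y)^4 * E y := hv
      _ = D * ((1+y)^4 * E y) := by ring
      _ ≤ (C+D1+D3) * ((1+y)^4 * E y) := by have := Epos y; gcongr
      _ ≤ (C+D1+D3) * (exp (25/(4*c)) * exp (-y)) := mul_le_mul_of_nonneg_left this (by positivity)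
      _ = _ := by ring
  have f0 : ∀ y, 0 ≤ y → |J y| ≤ ((C+D1+D3) * exp (25/(4*c))) * exp (-y) := fun y hy => by
    refine fin C y _ hy (by linarith) ((b0 y hy).trans ?_)
    have := Epos y
    have o1 : (1:ℝ) ≤ (1+y)^4 := one_le_pow₀ (by linarith)
    gcongr
    exact le_mul_of_one_le_right hCp o1
  refine ⟨(C+D1+D3) * exp (25/(4*c)), by positivity, f0, fun h hh => ?_⟩
  have key := trap_full J J1 J2 J3 d1 d2 d3 cJ3 ((C+D1+D3) * exp (25/(4*c))) f0
    (fun y hy => by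
      refine fin D1 y _ hy (by linarith) ((b1 y hy).trans ?_)
      have := Epos y
      have o2 : (1+y) ≤ (1+y)^4 := le_self_pow₀ (by linarith) (by norm_num)
      gcongr)
    (fun y hy => fin D3 y _ hy (by linarith) (b3 y hy)) h hh
  refine le_of_eq_of_le ?_ key
  simp [hJ1, hE]
  ring_nf

lemma lin_gauss_trap (c : ℝ) (hc : 0 < c) :
    ∃ M : ℝ, 0 ≤ M ∧ (∀ y, 0 ≤ y → |y * exp (-(c*y^2))| ≤ M * exp (-y)) ∧ ∀ h : ℝ, 0 < h →
      |h * (∑' n : ℕ, pw n * ((n*h) * exp (-(c*(n*h)^2)))) - 1/(2*c) + h^2/12| ≤ h^3/2 * M := by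
  set E := fun y : ℝ => exp (-(c*y^2)) with hE
  have dE : ∀ y, HasDerivAt E (-(2*c*y) * E y) y := fun y => gauss_deriv c y
  have hid : ∀ y : ℝ, HasDerivAt (fun y : ℝ => y) 1 y := fun y => hasDerivAt_id y
  have Epos : ∀ y, 0 < E y := fun y => exp_pos _
  set D := 1 + 2*c + 6*c+24*c^2+8*c^3 with hD
  have fin : ∀ y p : ℝ, 0 ≤ y → |p| ≤ D * (1+y)^4 → 
      |p * E y| ≤ (D * exp (25/(4*c))) * exp (-y) := fun y p hy hp =>
    poly_gauss' c y p _ D hc hy (Epos y).le le_rfl (by positivity) hp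
  have o : ∀ y : ℝ, 0 ≤ y → 1 ≤ (1+y)^4 ∧ y ≤ (1+y)^4 ∧ y^2 ≤ (1+y)^4 ∧ y^4 ≤ (1+y)^4 := by
    intro y hy
    have : (1+y)^2 ≤ (1+y)^4 := pow_le_pow_right₀ (by linarith) (by norm_num)
    refine ⟨one_le_pow₀ (by linarith), by nlinarith, by nlinarith, by gcongr; linarith⟩
  have f0 : ∀ y, 0 ≤ y → |y * E y| ≤ (D * exp (25/(4*c))) * exp (-y) := fun y hy => by
    refine fin y y hy ?_
    obtain ⟨o1, o2, o3, o4⟩ := o y hy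
    rw [abs_of_nonneg hy]
    have : 1 ≤ D := by rw [hD]; linarith [pow_pos hc 2, pow_pos hc 3]
    nlinarith
  refine ⟨D * exp (25/(4*c)), by positivity, f0, fun h hh => ?_⟩
  have key := trap_full (fun y => y * E y) (fun y => (1 - 2*c*y^2) * E y)
    (fun y => (-6*c*y+4*c^2*y^3) * E y) (fun y => (-6*c+24*c^2*y^2-8*c^3*y^4) * E y)
    (fun y => ((hid y).mul (dE y)).congr_deriv (by ring))
    (fun y => by
      have hp : HasDerivAt (fun y : ℝ => 1 - 2*c*y^2) (-(4*c*y)) y := by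
        refine ((((hid y).pow 2).const_mul (2*c)).const_sub 1).congr_deriv ?_
        simp; ring
      exact (hp.mul (dE y)).congr_deriv (by ring))
    (fun y => by
      have hp : HasDerivAt (fun y : ℝ => -6*c*y+4*c^2*y^3) (-6*c+12*c^2*y^2) y := by
        refine (((hid y).const_mul (-6*c)).add (((hid y).pow 3).const_mul (4*c^2))).congr_deriv ?_
        simp; ring
      exact (hp.mul (dE y)).congr_deriv (by ring))
    (by simp only [hE]; fun_prop) (D * exp (25/(4*c))) f0
    (fun y hy => by
      refine fin y _ hy ?_
      obtain ⟨o1, o2, o3, o4⟩ := o y hy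
      have c2 := pow_pos hc 2
      have c3 := pow_pos hc 3
      have : 0 ≤ c * y^2 := by positivity
      have h1 : c*y^2 ≤ c*(1+y)^4 := by gcongr
      have h2 : 0 ≤ (6*c+24*c^2+8*c^3) * (1+y)^4 := by positivity
      rw [hD, abs_le]; constructor <;> nlinarith)
    (fun y hy => by
      refine fin y _ hy ?_
      obtain ⟨o1, o2, o3, o4⟩ := o y hy
      have c2 := pow_pos hc 2
      have c3 := pow_pos hc 3
      have p2 : 0 ≤ c^2 * y^2 := by positivity
      have p3 : 0 ≤ c^3 * y^4 := by positivity
      have h0 : c*1 ≤ c*(1+y)^4 := by gcongr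
      have h1 : c^2*y^2 ≤ c^2*(1+y)^4 := by gcongr
      have h2 : c^3*y^4 ≤ c^3*(1+y)^4 := by gcongr
      have h4 : 0 ≤ (1+2*c) * (1+y)^4 := by positivity
      rw [hD, abs_le]; constructor <;> nlinarith)
    h hh
  have hInt0 : ∫ x in Ioi (0:ℝ), x * E x = 1/(2*c) := by
    have h1 : ∀ x ∈ Ici (0:ℝ), HasDerivAt (fun x => -(1/(2*c)) * E x) (x * E x) x := fun x _ => by
      refine ((dE x).const_mul _).congr_deriv ?_
      field_simp
    have h2 : Tendsto (fun x => -(1/(2*c)) * E x) atTop (𝓝 (-(1/(2*c)) * 0)) := by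
      refine Tendsto.const_mul _ (Real.tendsto_exp_atBot.comp (tendsto_neg_atTop_atBot.comp ?_))
      exact (tendsto_pow_atTop two_ne_zero).const_mul_atTop hc
    have := integral_Ioi_of_hasDerivAt_of_nonneg' h1 (fun x hx => mul_nonneg (le_of_lt hx) (Epos x).le) h2
    rw [this]; simp [hE]
  rw [hInt0] at key
  refine le_of_eq_of_le ?_ key
  simp [hE]

lemma exp_trap (h : ℝ) (hh : 0 < h) (h1 : h ≤ 1) :
    Summable (fun n : ℕ => pw n * exp (-(n*h))) ∧ h * (∑' n : ℕ, pw n * exp (-(n*h))) ≤ 2 := by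
  have d : ∀ x : ℝ, HasDerivAt (fun x => exp (-x)) (-exp (-x)) x := fun x => by
    simpa using ((hasDerivAt_id x).neg).exp
  have d' : ∀ x : ℝ, HasDerivAt (fun x => -exp (-x)) (exp (-x)) x := fun x => by
    exact (d x).neg.congr_deriv (neg_neg _)
  have key := trap_full (fun x => exp (-x)) (fun x => -exp (-x)) (fun x => exp (-x)) (fun x => -exp (-x))
    d d' d (by fun_prop) 1 (fun x _ => by simp) (fun x _ => by simp) (fun x _ => by simp) h hh
  refine ⟨?_, ?_⟩
  · have hs : Summable (fun n : ℕ => exp (-(n * h))) := by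
      have := Real.summable_exp_nat_mul_iff.2 (neg_lt_zero.2 hh)
      refine this.congr fun n => by ring_nf
    refine Summable.of_nonneg_of_le (fun n => ?_) (fun n => ?_) hs
    · have : 0 ≤ pw n := by unfold pw; split_ifs <;> norm_num
      positivity
    · have : pw n ≤ 1 := by unfold pw; split_ifs <;> norm_num
      nlinarith [exp_pos (-(n*h))]
  · rw [integral_exp_neg_Ioi] at key
    simp at key
    have := (abs_le.1 key).2
    have : h^2 ≤ 1 := pow_le_one₀ hh.le h1
    have : h^3 ≤ 1 := pow_le_one₀ hh.le h1
    linarith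
end

section
open Real MeasureTheory Filter Topology Set

lemma pw_nonneg (n : ℕ) : 0 ≤ pw n := by unfold pw; split_ifs <;> norm_num
lemma pw_le (n : ℕ) : pw n ≤ 1 := by unfold pw; split_ifs <;> norm_num

lemma quad_asymp (a b c : ℝ) (ha : 0 < a) (hb : 0 < b) (hc : 0 < c) :
    ∃ κ C : ℝ, ∀ h : ℝ, 0 < h → h ≤ 1 →
      |h^2 * (∑' z : ℕ × ℕ, pw z.1 * pw z.2 * exp (-(a*(z.2*h)^2+b*(z.2*h)*(z.1*h)+c*(z.1*h)^2))) - κ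
        - h^2 * (b/24*(1/a+1/c))| ≤ C * h^3 := by
  obtain ⟨M, hM, hMb, hMt⟩ := slice_trap a b c ha hb hc
  obtain ⟨M1, hM1, hM1b, hM1t⟩ := JJ_trap a b c ha hb hc
  obtain ⟨M2, hM2, hM2b, hM2t⟩ := lin_gauss_trap c hc
  refine ⟨∫ x in Ioi (0:ℝ), JJ a b c x, M + M1/2 + b/12*(1+M2), fun h hh h1 => ?_⟩
  obtain ⟨hs, hs2⟩ := exp_trap h hh h1
  have hsum2 : Summable (fun z : ℕ × ℕ => pw z.1 * pw z.2 * exp (-(a*(z.2*h)^2+b*(z.2*h)*(z.1*h)+c*(z.1*h)^2))) := by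
    have := (hs.mul_of_nonneg hs (fun n => mul_nonneg (pw_nonneg n) (exp_pos _).le) (fun n => mul_nonneg (pw_nonneg n) (exp_pos _).le)).mul_left M
    refine Summable.of_nonneg_of_le (fun z => ?_) (fun z => ?_) this
    · exact mul_nonneg (mul_nonneg (pw_nonneg _) (pw_nonneg _)) (exp_pos _).le
    · have := hMb (z.2*h) (z.1*h) (by positivity) (by positivity)
      calc _ ≤ pw z.1 * pw z.2 * (M * exp (-(z.2*h)) * exp (-(z.1*h))) := 
            mul_le_mul_of_nonneg_left this (mul_nonneg (pw_nonneg _) (pw_nonneg _))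
        _ = _ := by ring
  rw [hsum2.tsum_prod]
  set I : ℕ → ℝ := fun q => ∑' p : ℕ, pw p * exp (-(a*(p*h)^2+b*(p*h)*(q*h)+c*(q*h)^2)) with hI
  have e1 : ∀ q : ℕ, ∑' p : ℕ, pw q * pw p * exp (-(a*(p*h)^2+b*(p*h)*(q*h)+c*(q*h)^2)) = pw q * I q := by
    intro q
    rw [hI, ← tsum_mul_left]
    exact tsum_congr fun p => by ring
  have sI : Summable (fun q => pw q * I q) := by
    have := hsum2.prod
    refine this.congr fun q => e1 q
  simp only [e1]
  -- summability of the pieces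
  have sgen : ∀ (G : ℝ → ℝ) (N : ℝ), (∀ y, 0 ≤ y → |G y| ≤ N * exp (-y)) → Summable (fun n : ℕ => pw n * G (n*h)) := by
    intro G N hG
    refine Summable.of_norm_bounded (hs.mul_left N) fun n => ?_
    rw [norm_mul, Real.norm_eq_abs, Real.norm_eq_abs, abs_of_nonneg (pw_nonneg n)]
    calc pw n * |G (n*h)| ≤ pw n * (N * exp (-(n*h))) := mul_le_mul_of_nonneg_left (hG _ (by positivity)) (pw_nonneg n)
      _ = _ := by ring
  have sJ := sgen _ M1 hM1b
  have sK := sgen (fun y => y * exp (-(c*y^2))) M2 hM2b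
  have main : |h^2 * (∑' q, pw q * I q) - h * (∑' q : ℕ, pw q * JJ a b c (q*h)) 
      - h^2/12 * b * (h * (∑' q : ℕ, pw q * ((q*h) * exp (-(c*(q*h)^2)))))| ≤ h^3/2 * M * 2 := by
    have eq : h^2 * (∑' q, pw q * I q) - h * (∑' q : ℕ, pw q * JJ a b c (q*h)) 
      - h^2/12 * b * (h * (∑' q : ℕ, pw q * ((q*h) * exp (-(c*(q*h)^2))))) = 
      h * ∑' q : ℕ, (h * (pw q * I q) - pw q * JJ a b c (q*h) - h^2/12 * b * (pw q * ((q*h) * exp (-(c*(q*h)^2))))) := by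
      rw [((sI.mul_left h).sub sJ).tsum_sub (sK.mul_left _), (sI.mul_left h).tsum_sub sJ, tsum_mul_left, tsum_mul_left]
      ring
    rw [eq, abs_mul, abs_of_pos hh]
    have hb : ∀ q : ℕ, ‖h * (pw q * I q) - pw q * JJ a b c (q*h) - h^2/12 * b * (pw q * ((q*h) * exp (-(c*(q*h)^2))))‖ 
        ≤ h^3/2 * M * (pw q * exp (-(q*h))) := by
      intro q
      have := hMt (q*h) h (by positivity) hh
      rw [JJ_eq a b c ha] at this
      have e : h * (pw q * I q) - pw q * JJ a b c (q*h) - h^2/12 * b * (pw q * ((q*h) * exp (-(c*(q*h)^2)))) = 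
         pw q * (h * I q - JJ a b c (q*h) - h^2/12 * (b * (q*h) * exp (-(c*(q*h)^2)))) := by ring
      rw [e, Real.norm_eq_abs, abs_mul, abs_of_nonneg (pw_nonneg q)]
      calc _ ≤ pw q * (h ^ 3 / 2 * (M * exp (-(q * h)))) := mul_le_mul_of_nonneg_left this (pw_nonneg q)
        _ = _ := by ring
    have hsm := hs.mul_left (h^3/2*M)
    have := tsum_of_norm_bounded hsm.hasSum hb
    rw [Real.norm_eq_abs, tsum_mul_left] at this
    calc _ ≤ h * (h^3/2 * M * ∑' q : ℕ, pw q * exp (-(q*h))) := mul_le_mul_of_nonneg_left this hh.le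
      _ = h^3/2*M * (h * ∑' q : ℕ, pw q * exp (-(q*h))) := by ring
      _ ≤ h^3/2*M*2 := by gcongr
  have t1 := hM1t h hh
  have t2 := hM2t h hh
  set S := h^2 * (∑' q, pw q * I q)
  set TJ := h * (∑' q : ℕ, pw q * JJ a b c (q*h))
  set TK := h * (∑' q : ℕ, pw q * ((q*h) * exp (-(c*(q*h)^2))))
  set κ := ∫ x in Ioi (0:ℝ), JJ a b c x
  have t2' : |TK - 1/(2*c)| ≤ h * (1+M2) := by
    have hh2 : h^2 ≤ h := by nlinarith
    have hh3 : h^3 ≤ h := by nlinarith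
    have : h^3*M2 ≤ h * M2 := by gcongr
    have : 0 ≤ h * M2 := by positivity
    have : 0 ≤ h^2 := sq_nonneg h
    rw [abs_le] at t2 ⊢
    obtain ⟨t2a, t2b⟩ := t2
    constructor <;> linarith
  have t3 : |h^2/12*b*(TK - 1/(2*c))| ≤ h^3 * (b/12*(1+M2)) := by
    rw [abs_mul, abs_of_nonneg (by positivity : 0 ≤ h^2/12*b)]
    calc _ ≤ h^2/12*b * (h*(1+M2)) := by gcongr
      _ = _ := by ring
  have e : S - κ - h^2 * (b/24*(1/a+1/c)) = (S - TJ - h^2/12*b*TK) + (TJ - κ - h^2/12*(b/(2*a))) + h^2/12*b*(TK - 1/(2*c)) := by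
    field_simp; ring
  rw [e]
  calc _ ≤ _ := abs_add_three _ _ _
    _ ≤ h^3/2 * M * 2 + h^3/2*M1 + h^3 * (b/12*(1+M2)) := by gcongr
    _ = _ := by ring

/-- t-version -/
lemma quad_asymp_t (a b c : ℝ) (ha : 0 < a) (hb : 0 < b) (hc : 0 < c) :
    ∃ κ C : ℝ, ∀ t : ℝ, 0 < t → t ≤ 1 →
      |(∑' z : ℕ × ℕ, pw z.1 * pw z.2 * exp (-(a*z.1^2+b*z.1*z.2+c*z.2^2)*t)) - κ/t
        - (b/24*(1/a+1/c))| ≤ C * √t := by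
  obtain ⟨κ, C, hC⟩ := quad_asymp c b a hc hb ha
  refine ⟨κ, C, fun t ht ht1 => ?_⟩
  have := hC (√t) (Real.sqrt_pos.2 ht) (Real.sqrt_le_one.2 ht1)
  have e : ∀ z : ℕ × ℕ, pw z.1 * pw z.2 * exp (-(c*(z.2*√t)^2+b*(z.2*√t)*(z.1*√t)+a*(z.1*√t)^2)) = 
      pw z.1 * pw z.2 * exp (-(a*z.1^2+b*z.1*z.2+c*z.2^2)*t) := by
    intro z
    congr 2
    have := Real.sq_sqrt ht.le
    linear_combination (-(a*z.1^2+b*z.1*z.2+c*z.2^2)) * this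
  simp only [e, Real.sq_sqrt ht.le] at this
  have e3 : √t^3 = t * √t := by rw [pow_succ, Real.sq_sqrt ht.le]
  rw [e3] at this
  set S := ∑' z : ℕ × ℕ, pw z.1 * pw z.2 * exp (-(a*z.1^2+b*z.1*z.2+c*z.2^2)*t)
  have e4 : t * S - κ - t * (b/24*(1/c+1/a)) = t * (S - κ/t - (b/24*(1/a+1/c))) := by
    field_simp; ring
  rw [e4, abs_mul, abs_of_pos ht] at this
  have h5 : t * |S - κ/t - (b/24*(1/a+1/c))| ≤ t * (C * √t) := by linarith
  exact le_of_mul_le_mul_left h5 ht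
end

section
open Real MeasureTheory Filter Topology Set Asymptotics

/-- Small-time expansion of the theta series with weights `W` and values `Q`. -/
def Good (Q W : ℤ × ℤ → ℝ) (c : ℝ) : Prop :=
  (∀ m, 0 ≤ W m) ∧ (∃ μ : ℝ, 0 < μ ∧ ∀ m, W m ≠ 0 → μ ≤ Q m) ∧
  (∀ σ : ℝ, 1 < σ → Summable (fun m => W m / Q m ^ σ)) ∧
  (∀ t : ℝ, 0 < t → Summable (fun m => W m * exp (-Q m * t))) ∧
  ∃ κ C : ℝ, ∀ t : ℝ, 0 < t → t ≤ 1 →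
    |(∑' m, W m * exp (-Q m * t)) - κ/t - c| ≤ C * √t

lemma Good.add {Q W1 W2 : ℤ × ℤ → ℝ} {c1 c2 : ℝ} (h1 : Good Q W1 c1) (h2 : Good Q W2 c2) :
    Good Q (fun m => W1 m + W2 m) (c1 + c2) := by
  obtain ⟨p1, ⟨μ1, hμ1, q1⟩, r1, s1, κ1, C1, t1⟩ := h1
  obtain ⟨p2, ⟨μ2, hμ2, q2⟩, r2, s2, κ2, C2, t2⟩ := h2
  refine ⟨fun m => add_nonneg (p1 m) (p2 m), ⟨min μ1 μ2, lt_min hμ1 hμ2, fun m hm => ?_⟩, 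
    fun σ hσ => ?_, fun t ht => ?_, κ1 + κ2, C1 + C2, fun t ht ht1 => ?_⟩
  · by_cases h : W1 m = 0
    · have : W2 m ≠ 0 := fun h' => hm (by simp [h, h'])
      exact (min_le_right _ _).trans (q2 m this)
    · exact (min_le_left _ _).trans (q1 m h)
  · exact ((r1 σ hσ).add (r2 σ hσ)).congr fun m => by ring
  · exact ((s1 t ht).add (s2 t ht)).congr fun m => by ring
  · have e : ∑' m, (W1 m + W2 m) * exp (-Q m * t) = (∑' m, W1 m * exp (-Q m * t)) + ∑' m, W2 m * exp (-Q m * t) := by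
      rw [← (s1 t ht).tsum_add (s2 t ht)]
      exact tsum_congr fun m => by ring
    rw [e]
    have a1 := t1 t ht ht1
    have a2 := t2 t ht ht1
    have e2 : (∑' m, W1 m * exp (-Q m * t)) + (∑' m, W2 m * exp (-Q m * t)) - (κ1+κ2)/t - (c1+c2) = 
      ((∑' m, W1 m * exp (-Q m * t)) - κ1/t - c1) + ((∑' m, W2 m * exp (-Q m * t)) - κ2/t - c2) := by ring
    rw [e2]
    calc _ ≤ _ := abs_add_le _ _
      _ ≤ C1*√t + C2 * √t := add_le_add a1 a2
      _ = _ := by ring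

lemma Good.value {Q W : ℤ × ℤ → ℝ} {c : ℝ} (hg : Good Q W c)
    (Z : ℂ → ℂ) (hZhol : DifferentiableOn ℂ Z {(1 : ℂ)}ᶜ)
    (hZeq : ∀ s : ℂ, 1 < s.re → Z s = ∑' m, (W m : ℂ) * Complex.exp (-s * Complex.log (Q m : ℝ))) :
    Z 0 = c := by
  obtain ⟨hW, ⟨μ, hμ, hQ⟩, hr, hs, κ, C, hT⟩ := hg
  set f : ℝ → ℝ := fun t => ∑' m, W m * exp (-Q m * t) with hf
  set F : ℝ → ℂ := fun t => (f t : ℂ) with hF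
  have hf0 : ∀ t, 0 ≤ f t := fun t => tsum_nonneg fun m => mul_nonneg (hW m) (exp_pos _).le
  have hdec : ∀ t u : ℝ, 0 < t → t ≤ u → f u ≤ f t * exp (-μ * (u - t)) := by
    intro t u ht htu
    rw [hf, ← tsum_mul_right]
    refine (hs u (ht.trans_le htu)).tsum_le_tsum (fun m => ?_) ((hs t ht).mul_right _)
    by_cases h : W m = 0
    · simp [h]
    · rw [mul_assoc, ← exp_add]
      refine mul_le_mul_of_nonneg_left (exp_le_exp.2 ?_) (hW m)
      have := hQ m h
      nlinarith [mul_le_mul_of_nonneg_right this (sub_nonneg.2 htu)]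
  have hanti : AntitoneOn f (Ioi 0) := by
    intro t ht u hu htu
    refine (hdec t u ht htu).trans (mul_le_of_le_one_right (hf0 t) ?_)
    rw [exp_le_one_iff]; nlinarith
  have hloc : LocallyIntegrableOn F (Ioi 0) := by
    rw [locallyIntegrableOn_iff isOpen_Ioi.isLocallyClosed]
    intro k hk hkc
    exact ((hanti.mono hk).integrableOn_isCompact hkc).ofReal
  set H : ℝ → ℂ := fun t => (κ:ℂ) • (Ioc (0:ℝ) 1).indicator (fun t : ℝ => (t:ℂ)^(-1:ℂ)) t + (c:ℂ) • (Ioc (0:ℝ) 1).indicator (fun _ : ℝ => (1:ℂ)) t with hH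
  have hHloc : LocallyIntegrableOn H (Ioi 0) := by
    have i1 : LocallyIntegrableOn (fun t : ℝ => (t:ℂ)^(-1:ℂ)) (Ioi 0) := by
      refine ContinuousOn.locallyIntegrableOn ?_ measurableSet_Ioi
      intro t ht
      refine ContinuousAt.continuousWithinAt ?_
      simp only [Complex.cpow_neg_one]
      have : (t:ℂ) ≠ 0 := by exact_mod_cast (ne_of_gt ht)
      fun_prop (disch := assumption)
    have i2 : LocallyIntegrableOn (fun t : ℝ => (1:ℂ)) (Ioi 0) := 
      continuousOn_const.locallyIntegrableOn measurableSet_Ioi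
    rw [locallyIntegrableOn_iff isOpen_Ioi.isLocallyClosed] at i1 i2 ⊢
    intro k hk hkc
    exact (((i1 k hk hkc).indicator measurableSet_Ioc).smul (κ:ℂ)).add (((i2 k hk hkc).indicator measurableSet_Ioc).smul (c:ℂ))
  set F2 : ℝ → ℂ := fun t => F t - H t with hF2
  have hF2loc : LocallyIntegrableOn F2 (Ioi 0) := hloc.sub hHloc
  have hFtop : ∀ a : ℝ, F =O[atTop] fun x => x ^ a := by
    intro a
    have h1 : F =O[atTop] fun x => exp (-μ * x) := by
      refine IsBigO.of_bound (f 1 * exp μ) ?_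
      filter_upwards [eventually_ge_atTop 1] with t ht
      have := hdec 1 t one_pos ht
      rw [hF, Complex.norm_real, Real.norm_of_nonneg (hf0 t), Real.norm_of_nonneg (exp_pos _).le]
      refine this.trans (le_of_eq ?_)
      rw [mul_assoc, ← exp_add]; ring_nf
    exact h1.trans (isLittleO_exp_neg_mul_rpow_atTop hμ a).isBigO
  have hF2top : ∀ a : ℝ, F2 =O[atTop] fun x => x ^ a := by
    intro a
    refine (hFtop a).congr' ?_ EventuallyEq.rfl
    filter_upwards [eventually_gt_atTop 1] with t ht
    have : t ∉ Ioc (0:ℝ) 1 := fun h => absurd h.2 (not_le.2 ht)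
    simp [hF2, hH, this]
  have hev : ∀ᶠ t : ℝ in 𝓝[>] 0, 0 < t ∧ t ≤ 1 := by
    filter_upwards [Ioc_mem_nhdsGT (zero_lt_one' ℝ)] with t ht using ht
  have hF2bot : F2 =O[𝓝[>] 0] fun x => x ^ (-(-1/2 : ℝ)) := by
    refine IsBigO.of_bound C ?_
    filter_upwards [hev] with t ht
    have := hT t ht.1 ht.2
    have hm : t ∈ Ioc (0:ℝ) 1 := ht
    have e : F2 t = ((f t - κ/t - c : ℝ) : ℂ) := by
      simp [hF2, hH, hm, hF, Complex.cpow_neg_one]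
      ring
    rw [e, Complex.norm_real, Real.norm_eq_abs, show (-(-1/2 : ℝ)) = 1/2 by norm_num, ← Real.sqrt_eq_rpow, Real.norm_of_nonneg (Real.sqrt_nonneg t)]
    exact this
  have hFbot : F =O[𝓝[>] 0] fun x => x ^ (-(1 : ℝ)) := by
    refine IsBigO.of_bound (|κ| + |c| + |C|) ?_
    filter_upwards [hev] with t ht
    have h1 := hT t ht.1 ht.2
    rw [hF, Complex.norm_real, Real.norm_eq_abs, Real.rpow_neg_one, Real.norm_of_nonneg (inv_nonneg.2 ht.1.le)]
    have h2 : |f t| ≤ |κ/t| + |c| + |C| * √t := by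
      have e : f t = κ/t + c + (f t - κ/t - c) := by ring
      rw [e]
      refine (abs_add_three _ _ _).trans ?_
      gcongr
      refine h1.trans ?_
      gcongr
      exact le_abs_self C
    have h3 : 1 ≤ t⁻¹ := (one_le_inv₀ ht.1).2 ht.2
    have h4 : √t ≤ t⁻¹ := (Real.sqrt_le_one.2 ht.2).trans h3
    refine h2.trans ?_
    have e : |κ/t| = |κ| * t⁻¹ := by rw [abs_div, abs_of_pos ht.1]; rfl
    rw [e, add_mul, add_mul]
    gcongr
    exact le_mul_of_one_le_right (abs_nonneg _) h3
  have hM2 : ∀ s : ℂ, -1/2 < s.re → DifferentiableAt ℂ (mellin F2) s := fun s hs =>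
    mellin_differentiableAt_of_isBigO_rpow hF2loc (hF2top (-(s.re+1))) (by linarith) hF2bot hs
  have hMF : ∀ s : ℂ, 1 < s.re → mellin F s = Complex.Gamma s * Z s := by
    intro s hs1
    have := hasSum_mellin (a := fun m => (W m : ℂ)) (p := Q) (F := F) (s := s) 
      (fun m => by
        by_cases h : W m = 0
        · left; simp [h]
        · right; exact hμ.trans_le (hQ m h)) (by linarith)
      (fun t ht => by
        have := (hs t ht).hasSum
        have := Complex.hasSum_ofReal.2 this
        simpa [hF, hf] using this)
      (by
        refine (hr s.re hs1).congr fun m => ?_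
        rw [Complex.norm_real, Real.norm_of_nonneg (hW m)])
    rw [← this.tsum_eq, hZeq s hs1, ← tsum_mul_left]
    refine tsum_congr fun m => ?_
    by_cases h : W m = 0
    · simp [h]
    · have hq : (Q m : ℂ) ≠ 0 := by exact_mod_cast (hμ.trans_le (hQ m h)).ne'
      rw [mul_div_assoc, div_eq_mul_inv, ← Complex.cpow_neg, Complex.cpow_def_of_ne_zero hq]
      rw [mul_comm (Complex.log _)]
  have hident : ∀ s : ℂ, 1 < s.re → mellin F2 s = Complex.Gamma s * Z s - (κ / (s - 1) + c / s) := by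
    intro s hs1
    have c1 : MellinConvergent F s := mellinConvergent_of_isBigO_rpow hloc (hFtop (-(s.re+1))) (by linarith) hFbot hs1
    have c2 := hasMellin_cpow_Ioc (-1) (s := s) (by simp; linarith)
    have c3 := hasMellin_one_Ioc (s := s) (by linarith)
    have c4 := hasMellin_add (c2.1.const_smul (κ:ℂ)) (c3.1.const_smul (c:ℂ))
    have c5 := hasMellin_sub c1 c4.1
    rw [mellin_const_smul, mellin_const_smul, c2.2, c3.2] at c4
    rw [show mellin F2 s = _ from c5.2, c4.2, hMF s hs1]
    simp only [smul_eq_mul]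
    ring
  set G1 : ℂ → ℂ := fun s => (s-1) * Complex.Gamma (s+1) * Z s with hG1
  set G2 : ℂ → ℂ := fun s => s*(s-1)*mellin F2 s + κ * s + c * (s-1) with hG2
  have hG : ∀ s : ℂ, 1 < s.re → G1 s = G2 s := by
    intro s hs1
    have s0 : s ≠ 0 := by rintro rfl; simp at hs1; linarith
    have s1 : s - 1 ≠ 0 := by
      intro h
      have : s = 1 := by linear_combination h
      rw [this] at hs1; simp at hs1
    simp only [hG1, hG2]
    rw [hident s hs1, Complex.Gamma_add_one s s0]
    field_simp
    ring
  have dG1 : ∀ s : ℂ, -1/2 < s.re → s ≠ 1 → DifferentiableAt ℂ G1 s := by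
    intro s hs1 hne
    have hz : DifferentiableAt ℂ Z s := hZhol.differentiableAt (isOpen_compl_singleton.mem_nhds hne)
    have hgam : DifferentiableAt ℂ (fun s => Complex.Gamma (s+1)) s := by
      refine DifferentiableAt.comp s (Complex.differentiableAt_Gamma (s+1) fun m h => ?_) (by fun_prop)
      have := congrArg Complex.re h
      simp at this
      have : (0:ℝ) ≤ m := by positivity
      linarith
    simp only [hG1]
    fun_prop
  have dG2 : ∀ s : ℂ, -1/2 < s.re → DifferentiableAt ℂ G2 s := by
    intro s hs1
    have := hM2 s hs1
    simp only [hG2]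
    fun_prop
  have step : ∀ (U : Set ℂ) (z : ℂ), IsOpen U → Convex ℝ U → (∀ s ∈ U, -1/2 < s.re ∧ s ≠ 1) → z ∈ U →
      G1 =ᶠ[𝓝 z] G2 → EqOn G1 G2 U := by
    intro U z hU hc hUs hz he
    refine AnalyticOnNhd.eqOn_of_preconnected_of_eventuallyEq (𝕜 := ℂ) ?_ ?_ hc.isPreconnected hz he
    · exact DifferentiableOn.analyticOnNhd (fun s hs => (dG1 s (hUs s hs).1 (hUs s hs).2).differentiableWithinAt) hU
    · exact DifferentiableOn.analyticOnNhd (fun s hs => (dG2 s (hUs s hs).1).differentiableWithinAt) hU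
  have o1 : IsOpen {s : ℂ | 1 < s.re} := isOpen_lt continuous_const Complex.continuous_re
  have o2 : IsOpen {s : ℂ | -1/2 < s.re} := isOpen_lt continuous_const Complex.continuous_re
  have o3 : IsOpen {s : ℂ | 0 < s.im} := isOpen_lt continuous_const Complex.continuous_im
  have o4 : IsOpen {s : ℂ | s.re < 1} := isOpen_lt Complex.continuous_re continuous_const
  have st1 := step ({s : ℂ | -1/2 < s.re} ∩ {s : ℂ | 0 < s.im}) (2 + Complex.I) (o2.inter o3)
    ((convex_halfSpace_re_gt _).inter (convex_halfSpace_im_gt _))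
    (fun s hs => ⟨hs.1, fun h => by have := hs.2; simp [h] at this⟩) (by constructor <;> norm_num)
    (by
      filter_upwards [o1.mem_nhds (show (2 + Complex.I) ∈ {s : ℂ | 1 < s.re} by simp)] with s hs using hG s hs)
  have st2 := step ({s : ℂ | -1/2 < s.re} ∩ {s : ℂ | s.re < 1}) Complex.I (o2.inter o4)
    ((convex_halfSpace_re_gt _).inter (convex_halfSpace_re_lt _))
    (fun s hs => ⟨hs.1, fun h => by have := hs.2; simp [h] at this⟩) (by constructor <;> norm_num)
    (by
      filter_upwards [(o2.inter o3).mem_nhds (show (Complex.I) ∈ {s : ℂ | -1/2 < s.re} ∩ {s : ℂ | 0 < s.im} by constructor <;> norm_num)] with s hs using st1 hs)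
  have fin := st2 (show (0:ℂ) ∈ {s : ℂ | -1/2 < s.re} ∩ {s : ℂ | s.re < 1} by constructor <;> norm_num)
  simp [hG1, hG2] at fin
  exact fin
end

section
open Real Filter Topology Set

/-- oriented determinant -/
def dd (v w : ℤ × ℤ) : ℤ := v.2 * w.1 - v.1 * w.2

/-- half-weighted Heaviside function -/
def hv (n : ℤ) : ℝ := if 0 < n then 1 else if n = 0 then 1/2 else 0

def wz (v w m : ℤ × ℤ) : ℝ := if m = 0 then 0 else hv (dd m w) * hv (dd v m)

lemma wt_eq (v w m : ℤ × ℤ) (h : 0 < dd v w) :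
    wt ((v.1:ℝ), (v.2:ℝ)) ((w.1:ℝ), (w.2:ℝ)) m = wz v w m := by
  obtain ⟨v1, v2⟩ := v
  obtain ⟨w1, w2⟩ := w
  obtain ⟨m1, m2⟩ := m
  have hR : (0:ℝ) < v2 * w1 - v1 * w2 := by
    simp only [dd] at h
    exact_mod_cast h
  set D : ℝ := v2 * w1 - v1 * w2 with hD
  have c1 : (∃ x₁ x₂ : ℝ, 0 < x₁ ∧ 0 < x₂ ∧ ((m1 : ℝ), (m2 : ℝ)) = x₁ • ((v1:ℝ), (v2:ℝ)) + x₂ • ((w1:ℝ), (w2:ℝ))) ↔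
      0 < dd (m1, m2) (w1, w2) ∧ 0 < dd (v1, v2) (m1, m2) := by
    have e1 : 0 < dd (m1, m2) (w1, w2) ↔ (0:ℝ) < m2 * w1 - m1 * w2 := by simp only [dd]; norm_cast
    have e2 : 0 < dd (v1, v2) (m1, m2) ↔ (0:ℝ) < v2 * m1 - v1 * m2 := by simp only [dd]; norm_cast
    rw [e1, e2]
    simp only [Prod.smul_mk, Prod.mk_add_mk, Prod.mk.injEq, smul_eq_mul]
    constructor
    · rintro ⟨x1, x2, h1, h2, h3, h4⟩
      rw [h3, h4]
      have a1 := mul_pos h1 hR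
      have a2 := mul_pos h2 hR
      rw [hD] at a1 a2
      constructor <;> linarith
    · rintro ⟨h1, h2⟩
      refine ⟨_, _, div_pos h1 hR, div_pos h2 hR, ?_, ?_⟩
      · field_simp; rw [hD]; ring
      · field_simp; rw [hD]; ring
  have c2 : (∃ t : ℝ, 0 < t ∧ (((m1 : ℝ), (m2 : ℝ)) = t • ((v1:ℝ), (v2:ℝ)) ∨ ((m1 : ℝ), (m2 : ℝ)) = t • ((w1:ℝ), (w2:ℝ)))) ↔
      (0 < dd (m1, m2) (w1, w2) ∧ dd (v1, v2) (m1, m2) = 0) ∨ (dd (m1, m2) (w1, w2) = 0 ∧ 0 < dd (v1, v2) (m1, m2)) := by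
    have e1 : 0 < dd (m1, m2) (w1, w2) ↔ (0:ℝ) < m2 * w1 - m1 * w2 := by simp only [dd]; norm_cast
    have e2 : 0 < dd (v1, v2) (m1, m2) ↔ (0:ℝ) < v2 * m1 - v1 * m2 := by simp only [dd]; norm_cast
    have e3 : dd (m1, m2) (w1, w2) = 0 ↔ (m2 * w1 - m1 * w2 : ℝ) = 0 := by simp only [dd]; norm_cast
    have e4 : dd (v1, v2) (m1, m2) = 0 ↔ (v2 * m1 - v1 * m2 : ℝ) = 0 := by simp only [dd]; norm_cast
    rw [e1, e2, e3, e4]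
    simp only [Prod.smul_mk, Prod.mk.injEq, smul_eq_mul]
    constructor
    · rintro ⟨t, ht, ⟨h3, h4⟩ | ⟨h3, h4⟩⟩
      · left; rw [h3, h4]
        have a1 := mul_pos ht hR
        rw [hD] at a1
        constructor <;> linarith
      · right; rw [h3, h4]
        have a1 := mul_pos ht hR
        rw [hD] at a1
        constructor <;> linarith
    · rintro (⟨h1, h2⟩ | ⟨h1, h2⟩)
      · refine ⟨_, div_pos h1 hR, Or.inl ⟨?_, ?_⟩⟩
        · field_simp; rw [hD]; linear_combination w1 * h2
        · field_simp; rw [hD]; linear_combination w2 * h2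
      · refine ⟨_, div_pos h2 hR, Or.inr ⟨?_, ?_⟩⟩
        · field_simp; rw [hD]; linear_combination v1 * h1
        · field_simp; rw [hD]; linear_combination v2 * h1
  unfold wt wz
  simp only [c1, c2]
  by_cases hm : ((m1, m2) : ℤ × ℤ) = 0
  · obtain ⟨rfl, rfl⟩ : m1 = 0 ∧ m2 = 0 := by simpa [Prod.ext_iff] using hm
    simp [dd]
  · have hnz : ¬ (dd (m1, m2) (w1, w2) = 0 ∧ dd (v1, v2) (m1, m2) = 0) := by
      rintro ⟨h1, h2⟩
      apply hm
      simp only [dd] at h h1 h2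
      have k1 : m1 * (v2 * w1 - v1 * w2) = 0 := by linear_combination v1 * h1 + w1 * h2
      have k2 : m2 * (v2 * w1 - v1 * w2) = 0 := by linear_combination v2 * h1 + w2 * h2
      have := h.ne'
      simp_all
    rw [if_neg hm]
    generalize dd (m1, m2) (w1, w2) = A at *
    generalize dd (v1, v2) (m1, m2) = B at *
    unfold hv
    split_ifs <;> first | (norm_num; done) | (exfalso; omega)

lemma wz_add (v1 v2 v3 m : ℤ × ℤ) (h12 : 0 < dd v1 v2) (h23 : 0 < dd v2 v3) (h13 : 0 < dd v1 v3) :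
    wz v1 v3 m = wz v1 v2 m + wz v2 v3 m := by
  unfold wz
  by_cases hm : m = 0
  · simp [hm]
  simp only [if_neg hm]
  have hnz : ¬ (dd v1 m = 0 ∧ dd m v3 = 0) := by
    rintro ⟨h1, h2⟩
    apply hm
    have k1 : m.1 * dd v1 v3 = 0 := by
      simp only [dd] at *; linear_combination v3.1 * h1 + v1.1 * h2
    have k2 : m.2 * dd v1 v3 = 0 := by
      simp only [dd] at *; linear_combination v3.2 * h1 + v1.2 * h2
    have := h13.ne'
    ext <;> simp_all
  have id1 : dd m v2 * dd v1 v3 = -(dd v1 m) * dd v2 v3 + dd m v3 * dd v1 v2 := by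
    simp only [dd]; ring
  have id2 : dd v2 m = - dd m v2 := by simp only [dd]; ring
  rw [id2]
  generalize dd m v2 = x at *
  generalize dd v1 m = A at *
  generalize dd m v3 = C at *
  generalize dd v1 v3 = p at *
  generalize dd v2 v3 = q at *
  generalize dd v1 v2 = r at *
  have hx : ∀ y, hv (-y) = 1 - hv y := by
    intro y; unfold hv
    rcases lt_trichotomy y 0 with h | h | h
    · simp [h, h.le, not_lt.2 h.le, h.ne]
    · simp [h]; norm_num
    · simp [h, h.le, not_lt.2 h.le, h.ne']
  have pos : ∀ y, 0 < y → hv y = 1 := fun y h => by simp [hv, h]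
  have neg : ∀ y, y < 0 → hv y = 0 := fun y h => by simp [hv, not_lt.2 h.le, h.ne]
  have zer : hv 0 = 1/2 := by simp [hv]
  rw [hx]
  have xpos : 0 < x * p → hv x = 1 := fun h => pos x (pos_of_mul_pos_left h h13.le)
  have xneg : x * p < 0 → hv x = 0 := fun h => neg x (by by_contra h'; push Not at h'; nlinarith)
  rcases lt_trichotomy A 0 with hA | hA | hA
  · rcases lt_or_ge C 0 with hC | hC
    · rw [neg A hA, neg C hC]; ring
    · rw [neg A hA, xpos (by rw [id1]; nlinarith)]; ring
  · subst hA
    rcases lt_trichotomy C 0 with hC | hC | hC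
    · rw [neg C hC, xneg (by rw [id1]; nlinarith)]; ring
    · exact absurd ⟨rfl, hC⟩ hnz
    · rw [pos C hC, xpos (by rw [id1]; nlinarith)]; ring
  · rcases lt_trichotomy C 0 with hC | hC | hC
    · rw [neg C hC, xneg (by rw [id1]; nlinarith)]; ring
    · rw [hC, zer, pos A hA, xneg (by rw [id1, hC]; nlinarith)]; ring
    · rw [pos A hA, pos C hC]; ring

lemma quad_lower (a b c : ℝ) (ha : 0 < a) (hb : 0 < b) (hc : 0 < c) :
    ∃ μ : ℝ, 0 < μ ∧ ∀ p q : ℕ, μ * (p + q) ≤ a*p^2+b*p*q+c*q^2 ∧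
      ((p,q) ≠ (0,0) → μ/2 * ((p+1) * (q+1)) ≤ a*p^2+b*p*q+c*q^2) := by
  refine ⟨min a (min b c), by positivity, fun p q => ?_⟩
  have hμ : 0 < min a (min b c) := by positivity
  have h1 : min a (min b c) ≤ a := min_le_left _ _
  have h2 : min a (min b c) ≤ b := (min_le_right _ _).trans (min_le_left _ _)
  have h3 : min a (min b c) ≤ c := (min_le_right _ _).trans (min_le_right _ _)
  set μ := min a (min b c)
  have hp : (p:ℝ) ≤ p^2 := by exact_mod_cast Nat.le_self_pow two_ne_zero p
  have hq : (q:ℝ) ≤ q^2 := by exact_mod_cast Nat.le_self_pow two_ne_zero q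
  have g1 : μ * p^2 ≤ a * p^2 := by gcongr
  have g2 : μ * (p * q) ≤ b * (p * q) := by gcongr
  have g3 : μ * q^2 ≤ c * q^2 := by gcongr
  have g4 : 0 ≤ μ * (p*q) := by positivity
  constructor
  · nlinarith
  · intro hne
    have : (1:ℝ) ≤ p^2 + q^2 := by
      have : 1 ≤ p^2+q^2 := by
        rcases Nat.eq_zero_or_pos p with rfl | h
        · have : q ≠ 0 := fun h => hne (by simp [h])
          have : 0 < q^2 := by positivity
          omega
        · have : 0 < p^2 := by positivity
          omega
      exact_mod_cast this
    nlinarith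

lemma good_unimodular (a b c : ℝ) (ha : 0 < a) (hb : 0 < b) (hc : 0 < c) (Q : ℤ × ℤ → ℝ) (v w : ℤ × ℤ)
    (h : dd v w = 1) (hQ : ∀ p q : ℤ, Q (p * v.1 + q * w.1, p * v.2 + q * w.2) = a*p^2+b*p*q+c*q^2) :
    Good Q (wz v w) (-1/4 + b/24*(1/a+1/c)) := by
  obtain ⟨μ, hμ, hlow⟩ := quad_lower a b c ha hb hc
  set j : ℕ × ℕ → ℤ × ℤ := fun z => (z.1 * v.1 + z.2 * w.1, z.1 * v.2 + z.2 * w.2) with hj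
  have d1 : ∀ z, dd (j z) w = z.1 := fun z => by
    simp only [dd, hj] at *; linear_combination (z.1:ℤ) * h
  have d2 : ∀ z, dd v (j z) = z.2 := fun z => by
    simp only [dd, hj] at *; linear_combination (z.2:ℤ) * h
  have jinj : Function.Injective j := by
    intro z z' hz
    have e1 := d1 z; have e2 := d2 z
    rw [hz, d1] at e1
    rw [hz, d2] at e2
    ext
    · exact_mod_cast e1.symm
    · exact_mod_cast e2.symm
  have j0 : ∀ z, j z = 0 ↔ z = (0,0) := by
    intro z
    have : j (0,0) = 0 := by simp [hj]
    constructor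
    · intro hz; exact jinj (hz.trans this.symm)
    · rintro rfl; exact this
  have wj : ∀ z, wz v w (j z) = if z = (0,0) then 0 else pw z.1 * pw z.2 := by
    intro z
    have hvp : ∀ n : ℕ, hv (n:ℤ) = pw n := by
      intro n; unfold hv pw
      rcases Nat.eq_zero_or_pos n with rfl | hn
      · simp
      · simp [hn, hn.ne']
    unfold wz
    simp only [j0, d1, d2, hvp]
  have woff : ∀ m, m ∉ range j → wz v w m = 0 := by
    intro m hm
    unfold wz
    by_cases hm0 : m = 0
    · simp [hm0]
    rw [if_neg hm0]
    by_contra hne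
    have hn : ∀ n, hv n ≠ 0 → 0 ≤ n := by
      intro n hn
      by_contra h'
      push Not at h'
      apply hn
      simp [hv, not_lt.2 h'.le, h'.ne]
    have p1 := hn _ (left_ne_zero_of_mul hne)
    have p2 := hn _ (right_ne_zero_of_mul hne)
    apply hm
    refine ⟨((dd m w).toNat, (dd v m).toNat), ?_⟩
    simp only [hj, Int.toNat_of_nonneg p1, Int.toNat_of_nonneg p2]
    simp only [dd] at *
    ext
    · simp only; linear_combination m.1 * h
    · simp only; linear_combination m.2 * h
  have Qj : ∀ z, Q (j z) = a*z.1^2+b*z.1*z.2+c*z.2^2 := fun z => by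
    have := hQ z.1 z.2
    simpa [hj] using this
  have wj_le : ∀ z, wz v w (j z) ≤ 1 := by
    intro z
    rw [wj]
    split_ifs
    · norm_num
    · exact mul_le_one₀ (pw_le _) (pw_nonneg _) (pw_le _)
  have w0 : ∀ m, 0 ≤ wz v w m := by
    intro m
    by_cases hm : m ∈ range j
    · obtain ⟨z, rfl⟩ := hm
      rw [wj]
      split_ifs
      · exact le_rfl
      · exact mul_nonneg (pw_nonneg _) (pw_nonneg _)
    · rw [woff m hm]
  have hexps : ∀ t : ℝ, 0 < t → Summable (fun z : ℕ × ℕ => exp (-(a*z.1^2+b*z.1*z.2+c*z.2^2) * t)) := by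
    intro t ht
    have s1 : Summable (fun n : ℕ => exp (n * (-(μ * t)))) := Real.summable_exp_nat_mul_iff.2 (by have := mul_pos hμ ht; linarith)
    have s2 := s1.mul_of_nonneg s1 (fun _ => (exp_pos _).le) (fun _ => (exp_pos _).le)
    refine Summable.of_nonneg_of_le (fun _ => (exp_pos _).le) (fun z => ?_) s2
    rw [← exp_add]
    apply exp_le_exp.2
    have := mul_le_mul_of_nonneg_right (hlow z.1 z.2).1 ht.le
    linarith
  refine ⟨w0, ⟨μ/2, by positivity, ?_⟩, ?_, ?_, ?_⟩
  · intro m hm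
    have : m ∈ range j := by by_contra h'; exact hm (woff m h')
    obtain ⟨z, rfl⟩ := this
    rw [Qj]
    have hz : z ≠ (0,0) := by
      rintro rfl; simp [wj] at hm
    refine le_trans ?_ ((hlow z.1 z.2).2 hz)
    have h1 : (0:ℝ) ≤ z.1 := by positivity
    have h2 : (0:ℝ) ≤ z.2 := by positivity
    have : (1:ℝ) ≤ (z.1+1)*(z.2+1) := by nlinarith [mul_nonneg h1 h2]
    exact le_mul_of_one_le_right (by positivity) this
  · intro σ hσ
    rw [← jinj.summable_iff (fun m hm => by rw [woff m hm, zero_div])]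
    have s1 : Summable (fun n : ℕ => ((n+1:ℝ)^σ)⁻¹) := by
      have := (summable_nat_add_iff 1).2 (Real.summable_nat_rpow_inv.2 hσ)
      simpa using this
    have s2 := (s1.mul_of_nonneg s1 (fun _ => by positivity) (fun _ => by positivity)).mul_left ((μ/2)^σ)⁻¹
    refine Summable.of_nonneg_of_le (fun z => ?_) (fun z => ?_) s2
    · simp only [Function.comp]
      rw [Qj]
      have := w0 (j z)
      positivity
    · simp only [Function.comp]
      by_cases hz : z = (0,0)
      · rw [wj, if_pos hz, zero_div]; positivity
      · rw [Qj]
        have hl := (hlow z.1 z.2).2 hz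
        have e : ((μ/2)^σ)⁻¹ * (((z.1+1:ℝ)^σ)⁻¹ * ((z.2+1:ℝ)^σ)⁻¹) = 1 / (μ/2 * ((z.1+1) * (z.2+1)))^σ := by
          rw [Real.mul_rpow (by positivity) (by positivity), Real.mul_rpow (by positivity) (by positivity), one_div, mul_inv, mul_inv]
        rw [e]
        have := wj_le z
        gcongr
  · intro t ht
    rw [← jinj.summable_iff (fun m hm => by rw [woff m hm, zero_mul])]
    refine Summable.of_nonneg_of_le (fun z => ?_) (fun z => ?_) (hexps t ht)
    · exact mul_nonneg (w0 _) (exp_pos _).le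
    · simp only [Function.comp]
      rw [Qj]
      exact mul_le_of_le_one_left (exp_pos _).le (wj_le z)
  · obtain ⟨κ, C, hC⟩ := quad_asymp_t a b c ha hb hc
    refine ⟨κ, C, fun t ht ht1 => ?_⟩
    have := hC t ht ht1
    have e : ∑' m, wz v w m * exp (-Q m * t) = 
       (∑' z : ℕ × ℕ, pw z.1 * pw z.2 * exp (-(a*z.1^2+b*z.1*z.2+c*z.2^2)*t)) - 1/4 := by
      have hsup : Function.support (fun m => wz v w m * exp (-Q m * t)) ⊆ range j := by
        intro m hm
        by_contra h'
        exact hm (by simp [woff m h'])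
      rw [← jinj.tsum_eq hsup]
      have s1 : Summable (fun z : ℕ × ℕ => pw z.1 * pw z.2 * exp (-(a*z.1^2+b*z.1*z.2+c*z.2^2)*t)) := by
        refine Summable.of_nonneg_of_le (fun z => ?_) (fun z => ?_) (hexps t ht)
        · exact mul_nonneg (mul_nonneg (pw_nonneg _) (pw_nonneg _)) (exp_pos _).le
        · exact mul_le_of_le_one_left (exp_pos _).le (mul_le_one₀ (pw_le _) (pw_nonneg _) (pw_le _))
      have s2 := s1.hasSum.sub (hasSum_ite_eq ((0,0) : ℕ × ℕ) (1/4 : ℝ))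
      rw [← s2.tsum_eq]
      refine tsum_congr fun z => ?_
      rw [wj, Qj]
      by_cases hz : z = (0,0)
      · subst hz
        simp [pw]; norm_num
      · simp [hz]
    rw [e]
    refine le_of_eq_of_le ?_ this
    congr 1
    ring
end

section
open Finset

def LL (X : ℝ) (v : ℤ × ℤ) : ℝ := (v.1:ℝ) * X + (v.2:ℝ)

def QQ (N X Y : ℝ) (m : ℤ × ℤ) : ℝ := N * ((m.1:ℝ) * X + (m.2:ℝ)) * ((m.1:ℝ) * Y + (m.2:ℝ))

lemma LL_comb (X : ℝ) (m : ℤ) (v w : ℤ × ℤ) : LL X (v + m • w) = LL X v + m * LL X w := by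
  simp [LL]; ring

lemma good_cone (N X Y : ℝ) (hN : 0 < N) (v w : ℤ × ℤ) (h : dd v w = 1)
    (hv : 0 < LL X v) (hv' : 0 < LL Y v) (hw : 0 < LL X w) (hw' : 0 < LL Y w) :
    Good (QQ N X Y) (wz v w) (-1/4 + 1/24 * (LL X w / LL X v + LL Y w / LL Y v
      + LL X v / LL X w + LL Y v / LL Y w)) := by
  have := good_unimodular (N * LL X v * LL Y v) (N * (LL X v * LL Y w + LL Y v * LL X w))
    (N * LL X w * LL Y w) (by positivity) (by positivity) (by positivity) (QQ N X Y) v w h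
    (by intro p q; simp only [QQ, LL]; push_cast; ring)
  convert this using 1
  field_simp
  ring

lemma good_glue (N X Y : ℝ) (v1 v2 v3 : ℤ × ℤ) (c1 c2 : ℝ) (h12 : 0 < dd v1 v2) (h23 : 0 < dd v2 v3)
    (p1 : 0 < LL X v1) (p2 : 0 < LL X v2) (p3 : 0 < LL X v3)
    (g1 : Good (QQ N X Y) (wz v1 v2) c1) (g2 : Good (QQ N X Y) (wz v2 v3) c2) :
    0 < dd v1 v3 ∧ Good (QQ N X Y) (wz v1 v3) (c1 + c2) := by
  have h13 : 0 < dd v1 v3 := by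
    have e : LL X v2 * (dd v1 v3 : ℝ) = LL X v3 * (dd v1 v2 : ℝ) + LL X v1 * (dd v2 v3 : ℝ) := by
      simp only [LL, dd]; push_cast; ring
    have q1 : (0:ℝ) < dd v1 v2 := by exact_mod_cast h12
    have q2 : (0:ℝ) < dd v2 v3 := by exact_mod_cast h23
    have : 0 < LL X v2 * (dd v1 v3 : ℝ) := by rw [e]; positivity
    exact_mod_cast pos_of_mul_pos_right this p2.le
  refine ⟨h13, ?_⟩
  have : wz v1 v3 = fun m => wz v1 v2 m + wz v2 v3 m := funext fun m => wz_add v1 v2 v3 m h12 h23 h13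
  rw [this]
  exact g1.add g2

lemma good_run (N X Y : ℝ) (hN : 0 < N) (P R : ℤ × ℤ) (h : dd P R = 1)
    (hP : 0 < LL X P) (hP' : 0 < LL Y P) (hR : 0 < LL X R) (hR' : LL Y R < 0) (m : ℕ)
    (hm : 0 < LL Y (P + (m:ℤ) • R)) (j : ℕ) (hj : 1 ≤ j) (hjm : j ≤ m) :
    Good (QQ N X Y) (wz P (P + (j:ℤ) • R)) (-j/12 + 1/24 * (LL X R / LL X P + LL Y R / LL Y P
      - LL X R / LL X (P + (j:ℤ) • R) - LL Y R / LL Y (P + (j:ℤ) • R))) := by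
  have pX : ∀ i : ℕ, 0 < LL X (P + (i:ℤ) • R) := fun i => by
    rw [LL_comb]; push_cast; positivity
  have pY : ∀ i : ℕ, i ≤ m → 0 < LL Y (P + (i:ℤ) • R) := fun i hi => by
    rw [LL_comb] at hm ⊢
    push_cast at hm ⊢
    have : (i:ℝ) ≤ m := by exact_mod_cast hi
    nlinarith
  have dcons : ∀ i : ℕ, dd (P + (i:ℤ) • R) (P + ((i+1:ℕ):ℤ) • R) = 1 := fun i => by
    simp only [dd, Prod.fst_add, Prod.snd_add, Prod.smul_fst, Prod.smul_snd, smul_eq_mul] at h ⊢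
    push_cast
    linear_combination h
  have dj : ∀ i : ℕ, dd P (P + (i:ℤ) • R) = i := fun i => by
    simp only [dd, Prod.fst_add, Prod.snd_add, Prod.smul_fst, Prod.smul_snd, smul_eq_mul] at h ⊢
    linear_combination (i:ℤ) * h
  have key : ∀ p q ρ : ℝ, 0 < p → 0 < q → q = p + ρ → q / p + p / q = 2 + ρ / p - ρ / q := by
    intro p q ρ hp hq e
    have : ρ = q - p := by linarith
    subst this
    field_simp
    ring
  have step : ∀ i : ℕ, i + 1 ≤ m → Good (QQ N X Y) (wz (P + (i:ℤ) • R) (P + ((i+1:ℕ):ℤ) • R))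
      (-1/12 + 1/24 * (LL X R / LL X (P + (i:ℤ) • R) + LL Y R / LL Y (P + (i:ℤ) • R)
      - LL X R / LL X (P + ((i+1:ℕ):ℤ) • R) - LL Y R / LL Y (P + ((i+1:ℕ):ℤ) • R))) := by
    intro i hi
    convert good_cone N X Y hN _ _ (dcons i) (pX i) (pY i (by omega)) (pX (i+1)) (pY (i+1) hi) using 1
    have k1 := key _ _ (LL X R) (pX i) (pX (i+1)) (by rw [LL_comb, LL_comb]; push_cast; ring)
    have k2 := key _ _ (LL Y R) (pY i (by omega)) (pY (i+1) hi) (by rw [LL_comb, LL_comb]; push_cast; ring)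
    linear_combination (-1/24) * k1 + (-1/24) * k2
  induction j, hj using Nat.le_induction with
  | base =>
    have := step 0 hjm
    simpa using this
  | succ j hj ih =>
    have g := good_glue N X Y P _ _ _ _ (by rw [dj]; exact_mod_cast hj) (by rw [dcons]; norm_num)
      hP (pX j) (pX (j+1)) (ih (by omega)) (step j hjm)
    convert g.2 using 1
    push_cast
    ring

lemma good_chain (N : ℝ) (hN : 0 < N) (ℓ : ℕ) (b : ℕ → ℤ) (hb : ∀ n, 1 ≤ b n) (X Y : ℕ → ℝ)
    (hX : ∀ n ≤ ℓ, 0 < X n) (hY : ∀ n ≤ ℓ, Y n < 0)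
    (hXr : ∀ n < ℓ, X (n+1) = b n + (X n)⁻¹) (hYr : ∀ n < ℓ, Y (n+1) = b n + (Y n)⁻¹)
    (A : ℕ → ℤ × ℤ) (hA0 : A 0 = (0,1)) (hA1 : A 1 = (1,0))
    (hA : ∀ n < ℓ, A (n+2) = A n + b n • A (n+1)) (k : ℕ) (hk : 2 * k ≤ ℓ) :
    dd (A (2*k)) (A (2*k+1)) = 1 ∧ 0 < LL (X 0) (A (2*k)) ∧ 0 < LL (Y 0) (A (2*k)) ∧
    LL (X 0) (A (2*k+1)) = X (2*k) * LL (X 0) (A (2*k)) ∧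
    LL (Y 0) (A (2*k+1)) = Y (2*k) * LL (Y 0) (A (2*k)) ∧
    (1 ≤ k → 0 < dd (A 0) (A (2*k)) ∧ Good (QQ N (X 0) (Y 0)) (wz (A 0) (A (2*k)))
      (1/24 * (X 0 + Y 0 - X (2*k) - Y (2*k)) + 1/12 * ∑ i ∈ range k, ((b (2*i+1):ℝ) - b (2*i)))) := by
  induction k with
  | zero => simp [hA0, hA1, LL, dd]
  | succ k ih =>
    obtain ⟨i1, i2, i3, i4, i5, i6⟩ := ih (by omega)
    have x0 := hX (2*k) (by omega)
    have x1 := hX (2*k+1) (by omega)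
    have x2 := hX (2*k+2) (by omega)
    have y0 := hY (2*k) (by omega)
    have y1 := hY (2*k+1) (by omega)
    have y2 := hY (2*k+2) (by omega)
    have ex1 := hXr (2*k) (by omega)
    have ex2 := hXr (2*k+1) (by omega)
    have ey1 := hYr (2*k) (by omega)
    have ey2 := hYr (2*k+1) (by omega)
    have a2 := hA (2*k) (by omega)
    have a3 := hA (2*k+1) (by omega)
    rw [show 2*k+1+2 = 2*k+3 by ring, show 2*k+1+1 = 2*k+2 by ring] at a3
    rw [show 2*k+1+1 = 2*k+2 by ring] at ex2 ey2
    rw [show 2*(k+1) = 2*k+2 by ring, show 2*k+2+1 = 2*k+3 by ring]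
    set P := A (2*k) with hP
    set R := A (2*k+1) with hR
    have RX : 0 < LL (X 0) R := by rw [i4]; positivity
    have RY : LL (Y 0) R < 0 := by rw [i5]; exact mul_neg_of_neg_of_pos y0 i3
    have lx2 : LL (X 0) (A (2*k+2)) = X (2*k+1) * LL (X 0) R := by
      rw [a2, LL_comb, ex1, i4]; field_simp; ring
    have ly2 : LL (Y 0) (A (2*k+2)) = Y (2*k+1) * LL (Y 0) R := by
      have := y0.ne
      rw [a2, LL_comb, ey1, i5]; field_simp; ring
    have px2 : 0 < LL (X 0) (A (2*k+2)) := by rw [lx2]; positivity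
    have py2 : 0 < LL (Y 0) (A (2*k+2)) := by rw [ly2]; exact mul_pos_of_neg_of_neg y1 RY
    have lx3 : LL (X 0) (A (2*k+3)) = X (2*k+2) * LL (X 0) (A (2*k+2)) := by
      rw [a3, LL_comb, ex2, lx2]; field_simp; ring
    have ly3 : LL (Y 0) (A (2*k+3)) = Y (2*k+2) * LL (Y 0) (A (2*k+2)) := by
      have := y1.ne
      rw [a3, LL_comb, ey2, ly2]; field_simp; ring
    have d3 : dd (A (2*k+2)) (A (2*k+3)) = 1 := by
      rw [a3, a2]
      simp only [dd, Prod.fst_add, Prod.snd_add, Prod.smul_fst, Prod.smul_snd, smul_eq_mul] at i1 ⊢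
      linear_combination i1
    refine ⟨d3, px2, py2, lx3, ly3, fun _ => ?_⟩
    obtain ⟨m, hm⟩ := Int.eq_ofNat_of_zero_le (show 0 ≤ b (2*k) by linarith [hb (2*k)])
    have hm1 : 1 ≤ m := by have := hb (2*k); omega
    have a2' : A (2*k+2) = P + (m:ℤ) • R := by rw [a2, hm]
    have run := good_run N (X 0) (Y 0) hN P R i1 i2 i3 RX RY m (by rw [← a2']; exact py2) m hm1 le_rfl
    have dPA : dd P (A (2*k+2)) = m := by
      rw [a2']
      simp only [dd, Prod.fst_add, Prod.snd_add, Prod.smul_fst, Prod.smul_snd, smul_eq_mul] at i1 ⊢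
      linear_combination (m:ℤ) * i1
    have dPpos : 0 < dd P (A (2*k+2)) := by rw [dPA]; exact_mod_cast hm1
    rw [← a2'] at run
    have q1 : LL (X 0) R / LL (X 0) P = X (2*k) := by rw [i4]; field_simp
    have q2 : LL (Y 0) R / LL (Y 0) P = Y (2*k) := by rw [i5]; field_simp
    have q3 : LL (X 0) R / LL (X 0) (A (2*k+2)) = X (2*k+2) - b (2*k+1) := by
      rw [ex2, lx2]; field_simp; ring
    have q4 : LL (Y 0) R / LL (Y 0) (A (2*k+2)) = Y (2*k+2) - b (2*k+1) := by
      have := y1.ne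
      have := RY.ne
      rw [ey2, ly2]; field_simp; ring
    rw [q1, q2, q3, q4] at run
    have mb : (m:ℝ) = b (2*k) := by rw [hm]; simp
    rw [mb] at run
    rcases Nat.eq_zero_or_pos k with h0 | hkpos
    · subst h0
      refine ⟨dPpos, ?_⟩
      convert run using 1
      simp
      ring
    · obtain ⟨j1, j2⟩ := i6 hkpos
      have := good_glue N (X 0) (Y 0) (A 0) P _ _ _ j1 dPpos (by simp [hA0, LL]) i2 px2 j2 run
      refine ⟨this.1, ?_⟩
      convert this.2 using 1
      rw [sum_range_succ]
      ring

lemma alt_sum (a : ℕ → ℝ) (K : ℕ) :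
    ∑ i ∈ range K, (a (2*K-1-(2*i+1)) - a (2*K-1-2*i)) = ∑ i ∈ range (2*K), (-1)^i * a i := by
  have h1 : ∀ K, ∑ i ∈ range (2*K), (-1)^i * a i = ∑ i ∈ range K, (a (2*i) - a (2*i+1)) := by
    intro K
    induction K with
    | zero => simp
    | succ K ih =>
      rw [show 2*(K+1) = 2*K+1+1 by ring, sum_range_succ, sum_range_succ, ih, sum_range_succ]
      simp [pow_succ, pow_mul]
      ring
  rw [h1, ← sum_range_reflect]
  refine sum_congr rfl fun i hi => ?_
  have := mem_range.1 hi
  rw [show 2*K-1-(2*(K-1-i)+1) = 2*i by omega, show 2*K-1-2*(K-1-i) = 2*i+1 by omega]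

end

/- STATEMENT 18: ζ(0,𝔟) = (1/12)·Σ_{i=0}^{ℓ−1} (−1)^i a_i. -/
theorem stmt_18
    -- K is a real quadratic field with nontrivial automorphism `conj` and real embedding `ι`
    (K : Type) [Field K] [NumberField K] (hdeg : Module.finrank ℚ K = 2)
    (ι : K →+* ℝ) (conj : K ≃ₐ[ℚ] K) (hconj : conj ≠ AlgEquiv.refl)
    -- 𝔟 is a nonzero integral ideal with 𝔟⁻¹ = ℤ + ℤω
    (𝔟 : Ideal (𝓞 K)) (h𝔟 : 𝔟 ≠ 0) (ω : K)
    (hinv : ∀ x : K, x ∈ ((𝔟 : FractionalIdeal (𝓞 K)⁰ K))⁻¹ ↔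
      ∃ c d : ℤ, x = (c : K) + (d : K) * ω)
    (hω1 : 1 < ι ω) (hω'gt : -1 < ι (conj ω)) (hω'lt : ι (conj ω) < 0)
    -- purely periodic continued fraction expansion ω = [[a₀,…,a_{r−1}]]
    (r : ℕ) (hr : 0 < r) (a : ℕ → ℤ) (hapos : ∀ i, 1 ≤ a i) (haper : ∀ i, a (i + r) = a i)
    (w : ℕ → K) (hw0 : w 0 = ω) (hwgt : ∀ i, 1 < ι (w i))
    (hwrec : ∀ i, w i = (a i : K) + (w (i + 1))⁻¹) (hwper : ∀ i, w (i + r) = w i)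
    -- the even period
    (ℓ : ℕ) (hℓ : ℓ = if r % 2 = 0 then r else 2 * r)
    -- the sequences α, β
    (α β : ℤ → ℤ) (hαm1 : α (-1) = 0) (hα0 : α 0 = 1) (hβm1 : β (-1) = 1) (hβ0 : β 0 = 0)
    (hαrec : ∀ i : ℕ, i < ℓ → α ((i : ℤ) + 1) = a (ℓ - 1 - i) * α (i : ℤ) + α ((i : ℤ) - 1))
    (hβrec : ∀ i : ℕ, i < ℓ → β ((i : ℤ) + 1) = a (ℓ - 1 - i) * β (i : ℤ) + β ((i : ℤ) - 1))
    -- Z is the analytic continuation of the zeta function of (Q, σ)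
    (Z : ℂ → ℂ) (hZhol : DifferentiableOn ℂ Z {(1 : ℂ)}ᶜ)
    (hZeq : ∀ s : ℂ, 1 < s.re → Z s =
      ∑' m : ℤ × ℤ,
        (wt (0, 1) ((α ((ℓ : ℤ) - 1) : ℝ), (β ((ℓ : ℤ) - 1) : ℝ)) m : ℂ) *
          Complex.exp (-s * Complex.log
            (((Ideal.absNorm 𝔟 : ℝ) * ((m.1 : ℝ) * ι ω + (m.2 : ℝ)) *
              ((m.1 : ℝ) * ι (conj ω) + (m.2 : ℝ)) : ℝ)))) :
    Z 0 = (1 / 12 : ℂ) * ∑ i ∈ Finset.range ℓ, (-1 : ℂ) ^ i * (a i : ℂ) := by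
  have hN : (0:ℝ) < (Ideal.absNorm 𝔟 : ℝ) := by
    have : Ideal.absNorm 𝔟 ≠ 0 := fun h => h𝔟 (Ideal.absNorm_eq_zero_iff.1 h)
    exact_mod_cast Nat.pos_of_ne_zero this
  obtain ⟨k, hk1, hk⟩ : ∃ k, 1 ≤ k ∧ ℓ = 2 * k := by
    rw [hℓ]
    split_ifs with h
    · exact ⟨r / 2, by omega, by omega⟩
    · exact ⟨r, hr, rfl⟩
  have hwℓ : w ℓ = w 0 := by
    rw [hℓ]
    split_ifs with h
    · simpa using hwper 0
    · rw [two_mul, hwper r]; simpa using hwper 0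
  have hx : ∀ i, ι (w i) = a i + (ι (w (i+1)))⁻¹ := fun i => by
    conv_lhs => rw [hwrec i]
    simp
  have hy : ∀ i, ι (conj (w i)) = a i + (ι (conj (w (i+1))))⁻¹ := fun i => by
    conv_lhs => rw [hwrec i]
    simp
  have hyb : ∀ i, -1 < ι (conj (w i)) ∧ ι (conj (w i)) < 0 := by
    intro i
    induction i with
    | zero => rw [hw0]; exact ⟨hω'gt, hω'lt⟩
    | succ i ih =>
      have h1 := hy i
      have h2 : (1:ℝ) ≤ a i := by exact_mod_cast hapos i
      generalize ι (conj (w (i+1))) = z at *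
      have h3 : z⁻¹ < -1 := by linarith [ih.2]
      have hz : z < 0 := inv_lt_zero.1 (by linarith)
      have h4 : z * z⁻¹ = 1 := mul_inv_cancel₀ hz.ne
      exact ⟨by nlinarith, hz⟩
  have chain := good_chain (Ideal.absNorm 𝔟 : ℝ) hN ℓ (fun n => a (ℓ - 1 - n)) (fun n => hapos _)
    (fun n => ι (w (ℓ - n))) (fun n => ι (conj (w (ℓ - n))))
    (fun n _ => by have := hwgt (ℓ - n); linarith) (fun n _ => (hyb _).2)
    (fun n hn => by
      have := hx (ℓ - 1 - n)
      rw [show ℓ - 1 - n + 1 = ℓ - n by omega] at this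
      rw [show ℓ - (n + 1) = ℓ - 1 - n by omega]; exact this)
    (fun n hn => by
      have := hy (ℓ - 1 - n)
      rw [show ℓ - 1 - n + 1 = ℓ - n by omega] at this
      rw [show ℓ - (n + 1) = ℓ - 1 - n by omega]; exact this)
    (fun n => (α ((n:ℤ) - 1), β ((n:ℤ) - 1))) (by simp [hαm1, hβm1]) (by simp [hα0, hβ0])
    (fun n hn => by
      have e1 := hαrec n hn
      have e2 := hβrec n hn
      have c1 : (((n + 2 : ℕ) : ℤ) - 1) = (n:ℤ) + 1 := by push_cast; ring
      have c2 : (((n + 1 : ℕ) : ℤ) - 1) = (n:ℤ) := by push_cast; ring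
      simp only [c1, c2, e1, e2]
      ext <;> simp <;> ring) k hk.ge
  obtain ⟨hd, hg⟩ := chain.2.2.2.2.2 hk1
  simp only [← hk, Nat.sub_zero, Nat.sub_self, hwℓ, hw0] at hd hg
  have hg2 := hg.value Z hZhol (by
    intro s hs
    rw [hZeq s hs]
    refine tsum_congr fun m => ?_
    rw [← wt_eq _ _ m hd]
    simp only [QQ, Nat.cast_zero, zero_sub, hαm1, hβm1, Int.cast_zero, Int.cast_one])
  rw [hg2]
  have hs := alt_sum (fun n => (a n : ℝ)) k
  rw [← hk] at hs
  simp only [hs]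
  push_cast
  ring

end
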